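/- arXiv:2305.15633 — 2 statements merged into one kernel-verified Lean document; each statement's English description precedes it below -/
import Mathlib

section
/- (Christ–Kiselev lemma) Let X and Y be Banach spaces, let I ⊆ ℝ be an interval, and let K : I × I → B(X, Y) be continuous, where B(X, Y) is the space of bounded linear operators from X to Y with the operator norm. Let 1 ≤ p < q ≤ ∞ and A > 0, and suppose that for all f ∈ L^p(I; X) one has ‖ ∫_I K(t, s) f(s) ds ‖_{L^q_t(I; Y)} ≤ A ‖f‖_{L^p(I; X)}. Then there is a constant C depending only on p and q such that for all f ∈ L^p(I; X), ‖ ∫_{s ∈ I, s < t} K(t, s) f(s) ds ‖_{L^q_t(I; Y)} ≤ C A ‖f‖_{L^p(I; X)}. -/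
noncomputable section

open MeasureTheory Set
open scoped ENNReal

section ChristKiselev

open Filter Topology
open scoped NNReal

/-- A finite measure on `ℝ` without atoms has a median. -/
theorem exists_median (ν : Measure ℝ) [IsFiniteMeasure ν] [NullSingletonClass ν] :
    ∃ c : ℝ, ν (Iio c) ≤ ν univ / 2 ∧ ν (Ici c) ≤ ν univ / 2 := by
  have hcompl (x : ℝ) : ν.real (Iio x) + ν.real (Ici x) = ν.real univ := by
    rw [← compl_Iio]; exact measureReal_add_measureReal_compl measurableSet_Iio
  have hIic (x : ℝ) : ν.real (Iic x) = ν.real (Iio x) := measureReal_congr Iio_ae_eq_Iic.symm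
  suffices ∃ c, ν.real (Iic c) = ν.real univ / 2 by
    obtain ⟨c, hc⟩ := this
    rw [hIic] at hc
    have key (s : Set ℝ) (h : ν.real s = ν.real univ / 2) : ν s ≤ ν univ / 2 := by
      rw [← ENNReal.toReal_le_toReal (measure_ne_top _ _)
        (ENNReal.div_ne_top (measure_ne_top _ _) two_ne_zero), ENNReal.toReal_div]
      exact h.le
    exact ⟨c, key _ hc, key _ (by linarith [hcompl c])⟩
  have hcont : Continuous fun x => ν.real (Iic x) := by
    have h := (integrable_const (μ := ν) (1 : ℝ)).continuous_primitive 0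
    have h2 : (fun x => ν.real (Iic x)) =
        fun x => ν.real (Iic 0) + ∫ _ in (0 : ℝ)..x, (1 : ℝ) ∂ν := by
      ext x
      rw [← intervalIntegral.integral_Iic_sub_Iic (integrable_const _).integrableOn
        (integrable_const _).integrableOn]
      simp
    rw [h2]
    exact continuous_const.add h
  rcases eq_or_ne (ν.real univ) 0 with h0 | h0
  · refine ⟨0, ?_⟩
    rw [h0, zero_div]
    exact le_antisymm (h0 ▸ measureReal_mono (subset_univ _)) measureReal_nonneg
  have hlt : ν.real univ / 2 < ν.real univ :=
    half_lt_self (lt_of_le_of_ne measureReal_nonneg h0.symm)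
  have htop : Tendsto (fun x => ν.real (Iic x)) atTop (𝓝 (ν.real univ)) :=
    (ENNReal.tendsto_toReal (measure_ne_top _ _)).comp (tendsto_measure_Iic_atTop ν)
  have hbot : Tendsto (fun x => ν.real (Ici x)) atBot (𝓝 (ν.real univ)) :=
    (ENNReal.tendsto_toReal (measure_ne_top _ _)).comp (tendsto_measure_Ici_atBot ν)
  obtain ⟨b, hb⟩ := (htop.eventually (lt_mem_nhds hlt)).exists
  obtain ⟨a, ha⟩ := (hbot.eventually (lt_mem_nhds hlt)).exists
  refine mem_range_of_exists_le_of_exists_ge hcont ⟨a, ?_⟩ ⟨b, hb.le⟩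
  rw [hIic]
  linarith [hcompl a]

/-- An `L^p` function on the line splits at some point into two pieces of small norm. -/
theorem exists_eLpNorm_indicator_le {E : Type*} [NormedAddCommGroup E] {μ : Measure ℝ}
    [NullSingletonClass μ] {p : ℝ≥0∞} (hp0 : p ≠ 0) (hp : p ≠ ∞) {f : ℝ → E} (hf : MemLp f p μ) :
    ∃ c : ℝ, eLpNorm ((Iio c).indicator f) p μ ≤ 2⁻¹ ^ (1 / p.toReal) * eLpNorm f p μ ∧
      eLpNorm ((Ici c).indicator f) p μ ≤ 2⁻¹ ^ (1 / p.toReal) * eLpNorm f p μ := by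
  set ν := μ.withDensity fun x => ‖f x‖ₑ ^ p.toReal with hν
  have hfin : ∫⁻ x, ‖f x‖ₑ ^ p.toReal ∂μ ≠ ∞ :=
    (lintegral_rpow_enorm_lt_top_of_eLpNorm_lt_top hp0 hp hf.2).ne
  have : IsFiniteMeasure ν := isFiniteMeasure_withDensity hfin
  have : NullSingletonClass ν :=
    ⟨fun x => withDensity_absolutelyContinuous _ _ (measure_singleton x)⟩
  obtain ⟨c, h1, h2⟩ := exists_median ν
  have key (s : Set ℝ) (hs : MeasurableSet s) (h : ν s ≤ ν univ / 2) :
      eLpNorm (s.indicator f) p μ ≤ 2⁻¹ ^ (1 / p.toReal) * eLpNorm f p μ := by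
    rw [eLpNorm_indicator_eq_eLpNorm_restrict hs, eLpNorm_eq_lintegral_rpow_enorm_toReal hp0 hp,
      eLpNorm_eq_lintegral_rpow_enorm_toReal hp0 hp, ← ENNReal.mul_rpow_of_nonneg _ _ (by positivity)]
    refine ENNReal.rpow_le_rpow ?_ (by positivity)
    rwa [hν, withDensity_apply _ hs, withDensity_apply _ .univ, setLIntegral_univ,
      ENNReal.div_eq_inv_mul] at h
  exact ⟨c, key _ measurableSet_Iio h1, key _ measurableSet_Ici h2⟩

theorem eLpNorm_le_of_restrict_le {α E : Type*} [MeasurableSpace α] [NormedAddCommGroup E]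
    {μ : Measure α} {q : ℝ≥0∞} (hq : q ≠ 0) {g : α → E} {s : Set α} (hs : MeasurableSet s)
    {b : ℝ≥0∞} (h1 : eLpNorm g q (μ.restrict s) ≤ b) (h2 : eLpNorm g q (μ.restrict sᶜ) ≤ b) :
    eLpNorm g q μ ≤ 2 ^ (1 / q.toReal) * b := by
  rcases eq_or_ne q ∞ with rfl | hq'
  · simp only [ENNReal.toReal_top, div_zero, ENNReal.rpow_zero, one_mul]
    rw [eLpNorm_exponent_top] at *
    refine eLpNormEssSup_le_of_ae_enorm_bound ?_
    have a1 := (ae_le_eLpNormEssSup (f := g) (μ := μ.restrict s)).mono fun x hx => hx.trans h1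
    have a2 := (ae_le_eLpNormEssSup (f := g) (μ := μ.restrict sᶜ)).mono fun x hx => hx.trans h2
    rw [ae_restrict_iff' hs] at a1
    rw [ae_restrict_iff' hs.compl] at a2
    filter_upwards [a1, a2] with x x1 x2
    by_cases hx : x ∈ s
    exacts [x1 hx, x2 hx]
  · have hq0 : 0 < q.toReal := ENNReal.toReal_pos hq hq'
    rw [eLpNorm_eq_lintegral_rpow_enorm_toReal hq hq', one_div, ENNReal.rpow_inv_le_iff hq0] at *
    rw [ENNReal.mul_rpow_of_nonneg _ _ hq0.le, ENNReal.rpow_inv_rpow hq0.ne', two_mul,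
      ← lintegral_add_compl _ hs]
    exact add_le_add h1 h2

/-- A form of Fatou's lemma for `eLpNorm`: the limit function need not be measurable. -/
theorem eLpNorm_le_of_ae_enorm_le_liminf {α E : Type*} [MeasurableSpace α] [NormedAddCommGroup E]
    {μ : Measure α} {q : ℝ≥0∞} (hq : q ≠ 0) {g : α → E} {h : ℕ → α → E}
    (hm : ∀ n, AEStronglyMeasurable (h n) μ) {b : ℝ≥0∞} (hb : ∀ n, eLpNorm (h n) q μ ≤ b)
    (hg : ∀ᵐ x ∂μ, ‖g x‖ₑ ≤ liminf (fun n => ‖h n x‖ₑ) atTop) :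
    eLpNorm g q μ ≤ b := by
  have liminf_le {u : ℕ → ℝ≥0∞} {a : ℝ≥0∞} (hu : ∀ n, u n ≤ a) : liminf u atTop ≤ a := by
    simpa using liminf_le_liminf (f := atTop) (Eventually.of_forall hu)
  rcases eq_or_ne q ∞ with rfl | hq'
  · simp only [eLpNorm_exponent_top] at *
    refine eLpNormEssSup_le_of_ae_enorm_bound ?_
    have a1 : ∀ᵐ x ∂μ, ∀ n, ‖h n x‖ₑ ≤ b := ae_all_iff.2 fun n =>
      (ae_le_eLpNormEssSup (f := h n)).mono fun x hx => hx.trans (hb n)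
    filter_upwards [hg, a1] with x x1 x2
    exact x1.trans (liminf_le x2)
  · have hq0 : 0 < q.toReal := ENNReal.toReal_pos hq hq'
    simp only [eLpNorm_eq_lintegral_rpow_enorm_toReal hq hq', one_div,
      ENNReal.rpow_inv_le_iff hq0] at *
    calc ∫⁻ x, ‖g x‖ₑ ^ q.toReal ∂μ
        ≤ ∫⁻ x, liminf (fun n => ‖h n x‖ₑ ^ q.toReal) atTop ∂μ := by
          refine lintegral_mono_ae (hg.mono fun x hx => ?_)
          refine (ENNReal.rpow_le_rpow hx hq0.le).trans_eq ?_
          exact (ENNReal.orderIsoRpow q.toReal hq0).liminf_apply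
      _ ≤ liminf (fun n => ∫⁻ x, ‖h n x‖ₑ ^ q.toReal ∂μ) atTop :=
          lintegral_liminf_le' fun n => (hm n).enorm.pow_const _
      _ ≤ _ := liminf_le hb

variable {X Y : Type*} [NormedAddCommGroup X] [NormedSpace ℝ X]
  [NormedAddCommGroup Y] [NormedSpace ℝ Y]

theorem aestronglyMeasurable_setIntegral_Iio_kernel {μ : Measure ℝ} [SFinite μ]
    {K : ℝ → ℝ → X →L[ℝ] Y}
    (hK : AEStronglyMeasurable (fun ts : ℝ × ℝ => K ts.1 ts.2) (μ.prod μ)) {f : ℝ → X}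
    (hf : AEStronglyMeasurable f μ) :
    AEStronglyMeasurable (fun t => ∫ s, K t s (f s) ∂μ) μ ∧
      AEStronglyMeasurable (fun t => ∫ s in Iio t, K t s (f s) ∂μ) μ := by
  have h : AEStronglyMeasurable (fun ts : ℝ × ℝ => K ts.1 ts.2 (f ts.2)) (μ.prod μ) :=
    (ContinuousLinearMap.id ℝ (X →L[ℝ] Y)).aestronglyMeasurable_comp₂ hK hf.comp_snd
  refine ⟨h.integral_prod_right', ?_⟩
  have hs : MeasurableSet {ts : ℝ × ℝ | ts.2 < ts.1} :=
    measurableSet_lt measurable_snd measurable_fst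
  refine (h.indicator hs).integral_prod_right'.congr (.of_forall fun t => ?_)
  simp only
  rw [← integral_indicator measurableSet_Iio]
  rfl

/-- One halving step: a bound `B` for the truncated operator improves to
`2 ^ (1 / q - 1 / p) * B + 2 ^ (- 1 / p) * A`. -/
theorem eLpNorm_setIntegral_Iio_halving {μ : Measure ℝ} [SFinite μ] [NullSingletonClass μ]
    {p q : ℝ≥0∞} (hp0 : p ≠ 0) (hp : p ≠ ∞) (hq : 1 ≤ q) {K : ℝ → ℝ → X →L[ℝ] Y}
    (hK : AEStronglyMeasurable (fun ts : ℝ × ℝ => K ts.1 ts.2) (μ.prod μ))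
    (hint : ∀ f : ℝ → X, MemLp f p μ → ∀ᵐ t ∂μ, Integrable (fun s => K t s (f s)) μ)
    {A B : ℝ≥0∞}
    (hA : ∀ f : ℝ → X, MemLp f p μ →
      eLpNorm (fun t => ∫ s, K t s (f s) ∂μ) q μ ≤ A * eLpNorm f p μ)
    (hB : ∀ f : ℝ → X, MemLp f p μ →
      eLpNorm (fun t => ∫ s in Iio t, K t s (f s) ∂μ) q μ ≤ B * eLpNorm f p μ)
    (f : ℝ → X) (hf : MemLp f p μ) :
    eLpNorm (fun t => ∫ s in Iio t, K t s (f s) ∂μ) q μ ≤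
      (2 ^ (1 / q.toReal) * 2⁻¹ ^ (1 / p.toReal) * B + 2⁻¹ ^ (1 / p.toReal) * A) *
        eLpNorm f p μ := by
  have hq0 : q ≠ 0 := (zero_lt_one.trans_le hq).ne'
  obtain ⟨c, hc1, hc2⟩ := exists_eLpNorm_indicator_le hp0 hp hf
  set κ : ℝ≥0∞ := 2⁻¹ ^ (1 / p.toReal)
  set f₁ := (Iio c).indicator f with hf₁
  set f₂ := (Ici c).indicator f with hf₂
  have m1 : MemLp f₁ p μ := hf.indicator measurableSet_Iio
  have m2 : MemLp f₂ p μ := hf.indicator measurableSet_Ici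
  set S : (ℝ → X) → ℝ → Y := fun f t => ∫ s in Iio t, K t s (f s) ∂μ
  set T : (ℝ → X) → ℝ → Y := fun f t => ∫ s, K t s (f s) ∂μ
  set u : ℝ → Y := (Iio c).piecewise (S f₁) (S f₂) with hu
  set w : ℝ → Y := (Ici c).indicator (T f₁) with hw
  have hSm (g : ℝ → X) (hg : MemLp g p μ) : AEStronglyMeasurable (S g) μ :=
    (aestronglyMeasurable_setIntegral_Iio_kernel hK hg.1).2
  have hum : AEStronglyMeasurable u μ :=
    .piecewise measurableSet_Iio (hSm _ m1).restrict (hSm _ m2).restrict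
  have hwm : AEStronglyMeasurable w μ :=
    (aestronglyMeasurable_setIntegral_Iio_kernel hK m1.1).1.indicator measurableSet_Ici
  have hsplit : S f =ᵐ[μ] u + w := by
    filter_upwards [hint f hf] with t ht
    rcases lt_or_ge t c with htc | htc
    · have : u t + w t = S f₁ t := by simp [hu, hw, htc]
      rw [Pi.add_apply, this]
      refine setIntegral_congr_fun measurableSet_Iio fun s hs => ?_
      simp [hf₁, indicator_of_mem (show s ∈ Iio c from lt_trans hs htc)]
    · have : u t + w t = S f₂ t + T f₁ t := by simp [hu, hw, htc]
      rw [Pi.add_apply, this]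
      have e1 : T f₁ t = ∫ s in Iio c, K t s (f s) ∂μ := by
        rw [← integral_indicator measurableSet_Iio]
        refine integral_congr_ae (.of_forall fun s => ?_)
        by_cases hs : s ∈ Iio c <;> simp [hf₁, hs]
      have e2 : S f₂ t = ∫ s in Ico c t, K t s (f s) ∂μ := by
        rw [← Iio_inter_Ici.trans rfl, ← setIntegral_indicator measurableSet_Ici]
        refine integral_congr_ae (.of_forall fun s => ?_)
        by_cases hs : s ∈ Ici c <;> simp [hf₂, hs]
      rw [e1, e2, add_comm, ← setIntegral_union _ measurableSet_Ico ht.integrableOn ht.integrableOn,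
        Iio_union_Ico_eq_Iio htc]
      exact disjoint_left.2 fun x hx hx' => not_le_of_gt hx hx'.1
  have hu_le : eLpNorm u q μ ≤ 2 ^ (1 / q.toReal) * (B * (κ * eLpNorm f p μ)) := by
    refine eLpNorm_le_of_restrict_le hq0 (measurableSet_Iio (a := c)) ?_ ?_
    · rw [eLpNorm_congr_ae (piecewise_ae_eq_restrict measurableSet_Iio)]
      exact (eLpNorm_mono_measure _ Measure.restrict_le_self).trans
        ((hB f₁ m1).trans (mul_le_mul_right hc1 B))
    · rw [eLpNorm_congr_ae (piecewise_ae_eq_restrict_compl measurableSet_Iio)]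
      exact (eLpNorm_mono_measure _ Measure.restrict_le_self).trans
        ((hB f₂ m2).trans (mul_le_mul_right hc2 B))
  have hw_le : eLpNorm w q μ ≤ A * (κ * eLpNorm f p μ) :=
    (eLpNorm_indicator_le _).trans ((hA f₁ m1).trans (mul_le_mul_right hc1 A))
  rw [eLpNorm_congr_ae hsplit]
  refine (eLpNorm_add_le hum hwm hq).trans ((add_le_add hu_le hw_le).trans_eq ?_)
  ring

/-- Iterating an affine contraction improves any a priori bound to its fixed point. -/
theorem le_mul_of_contraction {ι : Type*} {x y : ι → ℝ≥0∞} {θ D : ℝ≥0} {a : ℝ≥0∞} (hθ : θ < 1)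
    (hD : (θ : ℝ≥0∞) * D + a = D) {M : ℝ≥0} (hM : ∀ i, x i ≤ M * y i) (hy : ∀ i, y i ≠ ∞)
    (step : ∀ B : ℝ≥0∞, (∀ i, x i ≤ B * y i) → ∀ i, x i ≤ (θ * B + a) * y i) (i : ι) :
    x i ≤ D * y i := by
  have h (n : ℕ) : ∀ i, x i ≤ (D + θ ^ n * M) * y i := by
    induction n with
    | zero => exact fun i => (hM i).trans (by gcongr; simp)
    | succ n ih =>
      refine fun i => (step _ ih i).trans_eq ?_
      rw [mul_add, add_right_comm, hD]
      ring
  have hlim : Tendsto (fun n : ℕ => ((D : ℝ≥0∞) + θ ^ n * M) * y i) atTop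
      (𝓝 ((D + 0 * M) * y i)) := by
    refine ENNReal.Tendsto.mul_const ?_ (Or.inr (hy i))
    refine tendsto_const_nhds.add (ENNReal.Tendsto.mul_const ?_ (Or.inr ENNReal.coe_ne_top))
    exact ENNReal.tendsto_pow_atTop_nhds_zero_of_lt_one (by exact_mod_cast hθ)
  simpa using ge_of_tendsto' hlim fun n => h n i

/-- The Christ–Kiselev lemma for a bounded kernel and a finite measure. -/
theorem eLpNorm_setIntegral_Iio_le_of_bounded {μ : Measure ℝ} [IsFiniteMeasure μ]
    [NullSingletonClass μ] {p q : ℝ≥0∞} (hp1 : 1 ≤ p) (hp : p ≠ ∞) (hq : 1 ≤ q)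
    {K : ℝ → ℝ → X →L[ℝ] Y}
    (hK : AEStronglyMeasurable (fun ts : ℝ × ℝ => K ts.1 ts.2) (μ.prod μ)) {M : ℝ≥0}
    (hM : ∀ᵐ t ∂μ, ∀ᵐ s ∂μ, ‖K t s‖ₑ ≤ M) {A : ℝ≥0∞}
    (hA : ∀ f : ℝ → X, MemLp f p μ →
      eLpNorm (fun t => ∫ s, K t s (f s) ∂μ) q μ ≤ A * eLpNorm f p μ)
    {θ D : ℝ≥0} (hθ : θ < 1) (hθ' : (θ : ℝ≥0∞) = 2 ^ (1 / q.toReal) * 2⁻¹ ^ (1 / p.toReal))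
    (hD : (θ : ℝ≥0∞) * D + 2⁻¹ ^ (1 / p.toReal) * A = D)
    (f : ℝ → X) (hf : MemLp f p μ) :
    eLpNorm (fun t => ∫ s in Iio t, K t s (f s) ∂μ) q μ ≤ D * eLpNorm f p μ := by
  have hbound (g : ℝ → X) : ∀ᵐ t ∂μ, ∫⁻ s, ‖K t s (g s)‖ₑ ∂μ ≤ M * eLpNorm g 1 μ := by
    filter_upwards [hM] with t ht
    rw [eLpNorm_one_eq_lintegral_enorm, ← lintegral_const_mul' _ _ ENNReal.coe_ne_top]
    refine lintegral_mono_ae (ht.mono fun s hs => ?_)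
    exact ((K t s).le_opENorm _).trans (by gcongr)
  have hint (g : ℝ → X) (hg : MemLp g p μ) : ∀ᵐ t ∂μ, Integrable (fun s => K t s (g s)) μ := by
    filter_upwards [hbound g, hK.prodMk_left] with t ht hKt
    refine ⟨(ContinuousLinearMap.id ℝ (X →L[ℝ] Y)).aestronglyMeasurable_comp₂ hKt hg.1, ?_⟩
    exact ht.trans_lt (ENNReal.mul_lt_top ENNReal.coe_lt_top (hg.mono_exponent hp1).2)
  set V : ℝ≥0∞ := M * μ univ ^ (1 / (1 : ℝ≥0∞).toReal - 1 / p.toReal) * μ univ ^ q.toReal⁻¹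
  have hexp : 0 ≤ 1 / (1 : ℝ≥0∞).toReal - 1 / p.toReal := by
    have : 1 ≤ p.toReal := by simpa using ENNReal.toReal_mono hp hp1
    simpa using inv_le_one_of_one_le₀ this
  have hV : V ≠ ∞ := by
    have h1 := ENNReal.rpow_ne_top_of_nonneg hexp (measure_ne_top μ univ)
    have h2 := ENNReal.rpow_ne_top_of_nonneg (inv_nonneg.2 q.toReal_nonneg) (measure_ne_top μ univ)
    exact ENNReal.mul_ne_top (ENNReal.mul_ne_top ENNReal.coe_ne_top h1) h2
  have hV' (g : ℝ → X) (hg : MemLp g p μ) :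
      eLpNorm (fun t => ∫ s in Iio t, K t s (g s) ∂μ) q μ ≤ V * eLpNorm g p μ := by
    have h1 : ∀ᵐ t ∂μ, ‖∫ s in Iio t, K t s (g s) ∂μ‖ₑ ≤ M * eLpNorm g 1 μ := by
      filter_upwards [hbound g] with t ht
      exact (enorm_integral_le_lintegral_enorm _).trans ((setLIntegral_le_lintegral _ _).trans ht)
    refine (eLpNorm_le_of_ae_enorm_bound h1).trans ?_
    have h2 := eLpNorm_le_eLpNorm_mul_rpow_measure_univ hp1 hg.1
    refine (mul_le_mul_left (mul_le_mul_right h2 (M : ℝ≥0∞)) _).trans_eq ?_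
    simp only [V]
    ring
  refine le_mul_of_contraction (ι := {g : ℝ → X // MemLp g p μ})
    (x := fun g => eLpNorm (fun t => ∫ s in Iio t, K t s (g.1 s) ∂μ) q μ)
    (y := fun g => eLpNorm g.1 p μ) (M := V.toNNReal) hθ hD ?_ (fun g => g.2.2.ne) ?_ ⟨f, hf⟩
  · rintro ⟨g, hg⟩
    rw [ENNReal.coe_toNNReal hV]
    exact hV' g hg
  · rintro B hB ⟨g, hg⟩
    rw [hθ']
    exact eLpNorm_setIntegral_Iio_halving (zero_lt_one.trans_le hp1).ne' hp hq hK hint hA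
      (fun g hg => hB ⟨g, hg⟩) g hg

/-- The hypothesis of the Christ–Kiselev lemma passes to subsets. -/
theorem eLpNorm_setIntegral_le_of_subset {I J : Set ℝ} (hJ : MeasurableSet J) (hJI : J ⊆ I)
    {p q : ℝ≥0∞} {K : ℝ → ℝ → X →L[ℝ] Y} {A : ℝ≥0∞}
    (hA : ∀ f : ℝ → X, MemLp f p (volume.restrict I) →
      eLpNorm (fun t => ∫ s in I, K t s (f s)) q (volume.restrict I) ≤
        A * eLpNorm f p (volume.restrict I))
    (f : ℝ → X) (hf : MemLp f p (volume.restrict J)) :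
    eLpNorm (fun t => ∫ s in J, K t s (f s)) q (volume.restrict J) ≤
      A * eLpNorm f p (volume.restrict J) := by
  have hr : (volume.restrict I).restrict J = volume.restrict J := by
    rw [Measure.restrict_restrict hJ, inter_eq_left.2 hJI]
  have h := hA (J.indicator f) (by rwa [memLp_indicator_iff_restrict hJ, hr])
  rw [eLpNorm_indicator_eq_eLpNorm_restrict hJ, hr] at h
  refine le_trans ?_ ((eLpNorm_mono_measure _ (Measure.restrict_mono hJI le_rfl)).trans h)
  refine le_of_eq (congrArg (fun g => eLpNorm g q (volume.restrict J)) (funext fun t => ?_))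
  rw [← hr, ← integral_indicator hJ]
  refine integral_congr_ae (.of_forall fun s => ?_)
  by_cases hs : s ∈ J <;> simp [hs]

/-- The Christ–Kiselev lemma on an open set. -/
theorem eLpNorm_setIntegral_Iio_le_of_isOpen {U : Set ℝ} (hU : IsOpen U) {p q : ℝ≥0∞}
    (hp1 : 1 ≤ p) (hp : p ≠ ∞) (hq : 1 ≤ q) {K : ℝ → ℝ → X →L[ℝ] Y}
    (hK : ContinuousOn (fun ts : ℝ × ℝ => K ts.1 ts.2) (U ×ˢ U)) {A : ℝ≥0∞}
    (hA : ∀ f : ℝ → X, MemLp f p (volume.restrict U) →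
      eLpNorm (fun t => ∫ s in U, K t s (f s)) q (volume.restrict U) ≤
        A * eLpNorm f p (volume.restrict U))
    {θ D : ℝ≥0} (hθ : θ < 1) (hθ' : (θ : ℝ≥0∞) = 2 ^ (1 / q.toReal) * 2⁻¹ ^ (1 / p.toReal))
    (hD : (θ : ℝ≥0∞) * D + 2⁻¹ ^ (1 / p.toReal) * A = D)
    (f : ℝ → X) (hf : MemLp f p (volume.restrict U)) :
    eLpNorm (fun t => ∫ s in U ∩ Iio t, K t s (f s)) q (volume.restrict U) ≤
      D * eLpNorm f p (volume.restrict U) := by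
  obtain ⟨F, hFc, hFU, hFe, hFm⟩ := hU.exists_iUnion_isClosed
  set J : ℕ → Set ℝ := fun n => F n ∩ Metric.closedBall 0 n with hJdef
  have hJc (n : ℕ) : IsCompact (J n) := (isCompact_closedBall _ _).inter_left (hFc n)
  have hJm (n : ℕ) : MeasurableSet (J n) := (hJc n).measurableSet
  have hJU (n : ℕ) : J n ⊆ U := inter_subset_left.trans (hFU n)
  have hJmono : Monotone J := fun m n hmn => inter_subset_inter (hFm hmn)
    (Metric.closedBall_subset_closedBall (by exact_mod_cast hmn))
  have hJe : ⋃ n, J n = U := by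
    rw [← hFe, hJdef, iUnion_inter_of_monotone hFm fun m n hmn =>
      Metric.closedBall_subset_closedBall (by exact_mod_cast hmn), Metric.iUnion_closedBall_nat,
      inter_univ]
  have hr (n : ℕ) : (volume.restrict U).restrict (J n) = volume.restrict (J n) := by
    rw [Measure.restrict_restrict (hJm n), inter_eq_left.2 (hJU n)]
  have hri (n : ℕ) (t : ℝ) :
      (volume.restrict (J n)).restrict (Iio t) = volume.restrict (J n ∩ Iio t) := by
    rw [Measure.restrict_restrict measurableSet_Iio, inter_comm]
  have hKJ (n : ℕ) : ContinuousOn (fun ts : ℝ × ℝ => K ts.1 ts.2) (J n ×ˢ J n) :=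
    hK.mono (prod_mono (hJU n) (hJU n))
  have hKm (n : ℕ) : AEStronglyMeasurable (fun ts : ℝ × ℝ => K ts.1 ts.2)
      ((volume.restrict (J n)).prod (volume.restrict (J n))) := by
    rw [Measure.prod_restrict]
    exact (hKJ n).aestronglyMeasurable ((hJm n).prod (hJm n))
  have hfJ (n : ℕ) : MemLp f p (volume.restrict (J n)) :=
    hf.mono_measure (Measure.restrict_mono (hJU n) le_rfl)
  refine eLpNorm_le_of_ae_enorm_le_liminf (zero_lt_one.trans_le hq).ne'
    (h := fun n => (J n).indicator fun t => ∫ s in J n ∩ Iio t, K t s (f s)) (fun n => ?_)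
    (fun n => ?_) ?_
  · rw [aestronglyMeasurable_indicator_iff (hJm n), hr]
    simpa only [hri] using (aestronglyMeasurable_setIntegral_Iio_kernel (hKm n) (hfJ n).1).2
  · rw [eLpNorm_indicator_eq_eLpNorm_restrict (hJm n), hr]
    have : IsFiniteMeasure (volume.restrict (J n)) := ⟨by simpa using (hJc n).measure_lt_top⟩
    obtain ⟨M, hM⟩ := ((hJc n).prod (hJc n)).exists_bound_of_continuousOn (hKJ n)
    have hM' : ∀ᵐ t ∂volume.restrict (J n), ∀ᵐ s ∂volume.restrict (J n),
        ‖K t s‖ₑ ≤ M.toNNReal := by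
      filter_upwards [ae_restrict_mem (hJm n)] with t ht
      filter_upwards [ae_restrict_mem (hJm n)] with s hs
      rw [← ofReal_norm]
      exact ENNReal.ofReal_le_ofReal (hM (t, s) ⟨ht, hs⟩)
    have h := eLpNorm_setIntegral_Iio_le_of_bounded hp1 hp hq (hKm n) hM'
      (eLpNorm_setIntegral_le_of_subset (hJm n) (hJU n) hA) hθ hθ' hD f (hfJ n)
    simp only [hri] at h
    exact h.trans (mul_le_mul_right
      (eLpNorm_mono_measure f (Measure.restrict_mono (hJU n) le_rfl)) _)
  · filter_upwards [ae_restrict_mem hU.measurableSet] with t ht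
    by_cases hi : IntegrableOn (fun s => K t s (f s)) (U ∩ Iio t)
    · have hun : ⋃ n, J n ∩ Iio t = U ∩ Iio t := by rw [← iUnion_inter, hJe]
      have h := tendsto_setIntegral_of_monotone (μ := volume) (f := fun s => K t s (f s))
        (s := fun n => J n ∩ Iio t) (fun n => (hJm n).inter measurableSet_Iio)
        (fun m n hmn => inter_subset_inter_left _ (hJmono hmn)) (by rwa [hun])
      rw [hun] at h
      obtain ⟨N, hN⟩ : ∃ N, t ∈ J N := mem_iUnion.1 (hJe ▸ ht)
      refine (Tendsto.liminf_eq ?_).ge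
      refine (h.congr' ?_).enorm
      filter_upwards [eventually_ge_atTop N] with n hn
      exact (indicator_of_mem (hJmono hn hN)
        fun t => ∫ s in J n ∩ Iio t, K t s (f s)).symm
    · rw [integral_undef hi, enorm_zero]
      exact zero_le

end ChristKiselev

/-- **Christ–Kiselev lemma** (Lemma 2.5). Let `X`, `Y` be Banach spaces, `I ⊆ ℝ` an
interval, and `K : I × I → B(X, Y)` a continuous kernel of bounded operators. If
`1 ≤ p < q ≤ ∞` and `A > 0` are such that
`‖ ∫_I K(t, s) f(s) ds ‖_{L^q_t(I; Y)} ≤ A ‖f‖_{L^p(I; X)}` for all `f ∈ L^p(I; X)`,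
then, with a constant `C` depending only on `p` and `q`,
`‖ ∫_{s ∈ I, s < t} K(t, s) f(s) ds ‖_{L^q_t(I; Y)} ≤ C A ‖f‖_{L^p(I; X)}`. -/
theorem christ_kiselev_lemma (p q : ℝ≥0∞) (hp : 1 ≤ p) (hpq : p < q) :
    ∃ C : ℝ, 0 < C ∧
      ∀ (X Y : Type)
        [NormedAddCommGroup X] [NormedSpace ℝ X] [CompleteSpace X]
        [NormedAddCommGroup Y] [NormedSpace ℝ Y] [CompleteSpace Y]
        (I : Set ℝ), I.OrdConnected →
        ∀ K : ℝ → ℝ → X →L[ℝ] Y,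
          ContinuousOn (fun ts : ℝ × ℝ => K ts.1 ts.2) (I ×ˢ I) →
          ∀ A : ℝ, 0 < A →
            (∀ f : ℝ → X, MemLp f p (volume.restrict I) →
              eLpNorm (fun t => ∫ s in I, K t s (f s)) q (volume.restrict I) ≤
                ENNReal.ofReal A * eLpNorm f p (volume.restrict I)) →
            ∀ f : ℝ → X, MemLp f p (volume.restrict I) →
              eLpNorm (fun t => ∫ s in I ∩ Iio t, K t s (f s)) q (volume.restrict I) ≤
                ENNReal.ofReal (C * A) * eLpNorm f p (volume.restrict I) := by
  have hp' : p ≠ ∞ := hpq.ne_top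
  have hp0 : 0 < p.toReal := ENNReal.toReal_pos (zero_lt_one.trans_le hp).ne' hp'
  have hexp : 1 / q.toReal < 1 / p.toReal := by
    rcases eq_or_ne q ∞ with rfl | hq
    · simpa using hp0
    · exact one_div_lt_one_div_of_lt hp0 ((ENNReal.toReal_lt_toReal hp' hq).2 hpq)
  set κ : NNReal := 2⁻¹ ^ (1 / p.toReal) with hκ
  set θ : NNReal := 2 ^ (1 / q.toReal) * κ with hθ
  have hκ0 : 0 < κ := NNReal.rpow_pos (by norm_num)
  have hκc : (κ : ℝ≥0∞) = 2⁻¹ ^ (1 / p.toReal) := by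
    rw [hκ, ENNReal.coe_rpow_of_nonneg _ (by positivity), ENNReal.coe_inv two_ne_zero]; rfl
  have hθc : (θ : ℝ≥0∞) = 2 ^ (1 / q.toReal) * 2⁻¹ ^ (1 / p.toReal) := by
    rw [hθ, ENNReal.coe_mul, hκc, ENNReal.coe_rpow_of_nonneg _ (by positivity)]; rfl
  have hθ1 : θ < 1 := by
    rw [hθ, hκ, NNReal.inv_rpow, ← div_eq_mul_inv, div_lt_one (NNReal.rpow_pos two_pos)]
    exact NNReal.rpow_lt_rpow_of_exponent_lt one_lt_two hexp
  have hθ1' : (0 : ℝ) < 1 - θ := sub_pos.2 (by exact_mod_cast hθ1)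
  refine ⟨κ / (1 - θ), div_pos hκ0 hθ1', ?_⟩
  intro X Y _ _ _ _ _ _ I hI K hK A hA hT f hf
  have hr : volume.restrict I = volume.restrict (interior I) :=
    Measure.restrict_congr_set
      (interior_ae_eq_of_null_frontier (hI.convex.addHaar_frontier volume)).symm
  have hri (t : ℝ) : volume.restrict (I ∩ Iio t) = volume.restrict (interior I ∩ Iio t) := by
    rw [inter_comm, inter_comm _ (Iio t), ← Measure.restrict_restrict measurableSet_Iio, hr,
      Measure.restrict_restrict measurableSet_Iio]
  simp only [hri, hr] at hT hf ⊢
  refine eLpNorm_setIntegral_Iio_le_of_isOpen isOpen_interior hp hp' (hp.trans hpq.le)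
    (hK.mono (prod_mono interior_subset interior_subset)) hT hθ1 hθc ?_ f hf
  rw [← hκc, ENNReal.ofReal]
  norm_cast
  ext
  have hC : (0 : ℝ) ≤ κ / (1 - θ) * A := by positivity
  push_cast
  rw [Real.coe_toNNReal _ hC, Real.coe_toNNReal _ hA.le]
  field_simp
  ring
end
end

section
/- Let d ≥ 2 and let u be a classical solution of the defocusing conformal nonlinear wave equation on ℝ × ℝ^d. Then there is a constant C depending only on d such that ∫_1^∞ ∫_{ℝ^d} |u(t, x)|^{2(d+1)/(d−1)} dx dt ≤ C 𝓔(1), where 𝓔 is the conformal energy of u. -/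
noncomputable section

open MeasureTheory Real Set
open scoped ENNReal RealInnerProductSpace

/-- Euclidean space `ℝ^d`. -/
abbrev Euc (d : ℕ) := EuclideanSpace ℝ (Fin d)

/-- The time derivative `∂ₜ u` of a function `u : ℝ × ℝ^d → ℝ` (in curried form). -/
def timeDeriv (d : ℕ) (u : ℝ → Euc d → ℝ) (t : ℝ) (x : Euc d) : ℝ :=
  deriv (fun s => u s x) t

/-- The second time derivative `∂ₜ² u`. -/
def timeDeriv2 (d : ℕ) (u : ℝ → Euc d → ℝ) (t : ℝ) (x : Euc d) : ℝ :=
  deriv (deriv (fun s => u s x)) t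

/-- The spatial Laplacian `Δf = ∑ⱼ ∂²f/∂xⱼ²`. -/
def spatialLap (d : ℕ) (f : Euc d → ℝ) (x : Euc d) : ℝ :=
  ∑ i : Fin d,
    fderiv ℝ (fun y => fderiv ℝ f y (EuclideanSpace.single i 1)) x (EuclideanSpace.single i 1)

/-- A function on `ℝ^d` is radial if it depends only on `|x|`. -/
def IsRadial (d : ℕ) (f : Euc d → ℝ) : Prop := ∃ g : ℝ → ℝ, ∀ x, f x = g ‖x‖

/-- A classical solution of the defocusing conformal nonlinear wave equation
`∂ₜ²u − Δu + |u|^{4/(d−1)} u = 0`: a smooth function satisfying the equation pointwise,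
whose time slices `u(t, ⬝)` and `∂ₜu(t, ⬝)` are (smooth and) compactly supported. -/
def IsClassicalSolution (d : ℕ) (u : ℝ → Euc d → ℝ) : Prop :=
  ContDiff ℝ (⊤ : ℕ∞) (Function.uncurry u) ∧
  (∀ t, HasCompactSupport (u t)) ∧
  (∀ t, HasCompactSupport (fun x => timeDeriv d u t x)) ∧
  (∀ t x, timeDeriv2 d u t x - spatialLap d (u t) x
      + |u t x| ^ ((4 : ℝ) / ((d : ℝ) - 1)) * u t x = 0)

/-- The homogeneous Sobolev norm `‖f‖_{Ḣ^s} = (∫ |ξ|^{2s} |f̂(ξ)|² dξ)^{1/2}`,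
valued in `[0, ∞]`. -/
def sobolevNorm (d : ℕ) (s : ℝ) (f : Euc d → ℝ) : ℝ≥0∞ :=
  (∫⁻ ξ : Euc d,
    ENNReal.ofReal (‖ξ‖ ^ (2 * s) * ‖FourierTransform.fourier (fun x => (f x : ℂ)) ξ‖ ^ 2)) ^
    ((1 : ℝ) / 2)

/-- The space-time Lebesgue norm `‖u‖_{L^r_{t,x}(ℝ × ℝ^d)}`, valued in `[0, ∞]`. -/
def spacetimeNorm (d : ℕ) (r : ℝ≥0∞) (u : ℝ → Euc d → ℝ) : ℝ≥0∞ :=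
  eLpNorm (Function.uncurry u) r volume

/-- The radial derivative `(x/|x|)·∇u` (interpreted as `0` at `x = 0`). -/
def radialDeriv (d : ℕ) (u : ℝ → Euc d → ℝ) (t : ℝ) (x : Euc d) : ℝ :=
  ⟪x, gradient (u t) x⟫ / ‖x‖

/-- `Lu = ∂ₜu + (x/|x|)·∇u`. -/
def Lop (d : ℕ) (u : ℝ → Euc d → ℝ) (t : ℝ) (x : Euc d) : ℝ :=
  timeDeriv d u t x + radialDeriv d u t x

/-- `L̲u = ∂ₜu − (x/|x|)·∇u`. -/
def Lbar (d : ℕ) (u : ℝ → Euc d → ℝ) (t : ℝ) (x : Euc d) : ℝ :=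
  timeDeriv d u t x - radialDeriv d u t x

/-- The squared angular gradient `|∇̸u|² = |∇u|² − ((x/|x|)·∇u)²`. -/
def angularGradSq (d : ℕ) (u : ℝ → Euc d → ℝ) (t : ℝ) (x : Euc d) : ℝ :=
  ‖gradient (u t) x‖ ^ 2 - (radialDeriv d u t x) ^ 2

/-- The conformal energy
`𝓔(t) = (1/4)∫ |(t+|x|)Lu + (d−1)u|² + |(t−|x|)L̲u + (d−1)u|² dx
+ (1/2)∫ (t²+|x|²)|∇̸u|² dx + ((d−1)/(4(d+1)))∫ (t²+|x|²)|u|^{2(d+1)/(d−1)} dx`. -/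
def conformalEnergy (d : ℕ) (u : ℝ → Euc d → ℝ) (t : ℝ) : ℝ :=
  (1 / 4) * (∫ x : Euc d,
      (((t + ‖x‖) * Lop d u t x + ((d : ℝ) - 1) * u t x) ^ 2 +
        ((t - ‖x‖) * Lbar d u t x + ((d : ℝ) - 1) * u t x) ^ 2)) +
  (1 / 2) * (∫ x : Euc d, (t ^ 2 + ‖x‖ ^ 2) * angularGradSq d u t x) +
  (((d : ℝ) - 1) / (4 * ((d : ℝ) + 1))) *
    (∫ x : Euc d, (t ^ 2 + ‖x‖ ^ 2) * |u t x| ^ (2 * ((d : ℝ) + 1) / ((d : ℝ) - 1)))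

/-- If `f` vanishes outside a ball and has continuous line derivative in direction `v`,
then the integral of that line derivative vanishes. -/
theorem integral_eq_zero_of_hasLineDerivAt {E : Type*} [NormedAddCommGroup E] [NormedSpace ℝ E]
    [FiniteDimensional ℝ E] [MeasurableSpace E] [BorelSpace E] (μ : Measure E)
    [μ.IsAddHaarMeasure] {f f' : E → ℝ} {v : E} (hf : Integrable f μ) (hf' : Integrable f' μ)
    (h : ∀ x, HasLineDerivAt ℝ f (f' x) x v) : ∫ x, f' x ∂μ = 0 := by
  have := integral_bilinear_hasLineDerivAt_right_eq_neg_left_of_integrable (μ := μ)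
    (f := fun _ : E => (1 : ℝ)) (f' := fun _ => 0) (g := f) (g' := f') (v := v)
    (B := ContinuousLinearMap.mul ℝ ℝ) (by simp) (by simpa using hf') (by simpa using hf)
    (fun x _ => by simpa [HasLineDerivAt] using hasDerivAt_const (0 : ℝ) (1 : ℝ))
    (fun x _ => h x)
  simpa using this

theorem HasLineDerivAt.eq_zero_of_norm_lt {E : Type*} [NormedAddCommGroup E] [NormedSpace ℝ E]
    {f : E → ℝ} {f' r : ℝ} {x v : E} (h : HasLineDerivAt ℝ f f' x v)
    (hf : ∀ y, r < ‖y‖ → f y = 0) (hx : r < ‖x‖) : f' = 0 := by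
  have hev : (fun s : ℝ => f (x + s • v)) =ᶠ[nhds 0] fun _ => 0 := by
    have hc : Continuous fun s : ℝ => ‖x + s • v‖ := by fun_prop
    filter_upwards [(isOpen_lt continuous_const hc).mem_nhds (by simpa using hx)] with s hs
    exact hf _ hs
  exact HasDerivAt.unique h ((hasDerivAt_const (0 : ℝ) (0 : ℝ)).congr_of_eventuallyEq hev)

theorem integrable_of_eq_zero_of_norm_lt {E : Type*} [NormedAddCommGroup E] [NormedSpace ℝ E]
    [FiniteDimensional ℝ E] [MeasurableSpace E] [BorelSpace E] (μ : Measure E)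
    [IsFiniteMeasureOnCompacts μ] {f : E → ℝ} {r : ℝ} (hf : Continuous f)
    (hr : ∀ x, r < ‖x‖ → f x = 0) : Integrable f μ := by
  have := FiniteDimensional.proper ℝ E
  refine hf.integrable_of_hasCompactSupport
    (HasCompactSupport.intro (isCompact_closedBall (0 : E) r) fun x hx => hr x ?_)
  simpa using hx

/-- A density `F` with `∂ₜF ≤ div V`, where `F` and `V` vanish outside a fixed ball, has
nonincreasing integral. -/
theorem integral_le_of_deriv_le_divergence {E ι : Type*} [NormedAddCommGroup E] [NormedSpace ℝ E]
    [FiniteDimensional ℝ E] [MeasurableSpace E] [BorelSpace E] (μ : Measure E)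
    [μ.IsAddHaarMeasure] [Fintype ι] {a b r : ℝ} (hab : a ≤ b) {e : ι → E}
    {F F' : ℝ → E → ℝ} {V D : ι → ℝ → E → ℝ}
    (hF : Continuous (Function.uncurry F))
    (hF' : ∀ t x, HasDerivAt (fun s => F s x) (F' t x) t)
    (hV : ∀ i, Continuous (Function.uncurry (V i)))
    (hD : ∀ i, Continuous (Function.uncurry (D i)))
    (hVD : ∀ i t x, HasLineDerivAt ℝ (V i t) (D i t x) x (e i))
    (hF0 : ∀ t ∈ Icc a b, ∀ x, r < ‖x‖ → F t x = 0)
    (hV0 : ∀ i, ∀ t ∈ Icc a b, ∀ x, r < ‖x‖ → V i t x = 0)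
    (hle : ∀ t ∈ Ioo a b, ∀ x, F' t x ≤ ∑ i, D i t x) :
    ∫ x, F b x ∂μ ≤ ∫ x, F a x ∂μ := by
  have := FiniteDimensional.proper ℝ E
  have hcont : ∀ {G : ℝ → E → ℝ}, Continuous (Function.uncurry G) → ∀ t, Continuous (G t) :=
    fun hG t => hG.comp (Continuous.prodMk_right t)
  have hD0 : ∀ i, ∀ t ∈ Icc a b, ∀ x, r < ‖x‖ → D i t x = 0 := fun i t ht x hx =>
    (hVD i t x).eq_zero_of_norm_lt (hV0 i t ht) hx
  have hDint : ∀ t ∈ Icc a b, ∫ x, ∑ i, D i t x ∂μ = 0 := by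
    intro t ht
    have hDi : ∀ i, Integrable (D i t) μ := fun i =>
      integrable_of_eq_zero_of_norm_lt μ (hcont (hD i) t) (hD0 i t ht)
    rw [integral_finsetSum _ fun i _ => hDi i]
    exact Finset.sum_eq_zero fun i _ => integral_eq_zero_of_hasLineDerivAt μ
      (integrable_of_eq_zero_of_norm_lt μ (hcont (hV i) t) (hV0 i t ht)) (hDi i) (hVD i t)
  have hS : Continuous fun p : E × ℝ => ∑ i, D i p.2 p.1 :=
    continuous_finsetSum _ fun i _ => (hD i).comp continuous_swap
  have hpt : ∀ x, F b x - F a x ≤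
      (Metric.closedBall (0 : E) r).indicator (fun x => ∫ t in Ioc a b, ∑ i, D i t x) x := by
    intro x
    by_cases hx : x ∈ Metric.closedBall (0 : E) r
    · rw [indicator_of_mem hx, ← intervalIntegral.integral_of_le hab]
      have hFx : Continuous fun s => F s x := hF.comp (Continuous.prodMk_left x)
      have hSx : Continuous fun s => ∑ i, D i s x := hS.comp (Continuous.prodMk_right x)
      exact intervalIntegral.sub_le_integral_of_hasDeriv_right_of_le hab hFx.continuousOn
        (fun t _ => (hF' t x).hasDerivWithinAt) hSx.integrableOn_Icc (fun t ht => hle t ht x)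
    · rw [indicator_of_notMem hx]
      have hx' : r < ‖x‖ := by simpa using hx
      simp [hF0 a (left_mem_Icc.2 hab) x hx', hF0 b (right_mem_Icc.2 hab) x hx']
  have hprod : Integrable (Function.uncurry fun (x : E) (t : ℝ) => ∑ i, D i t x)
      ((μ.restrict (Metric.closedBall (0 : E) r)).prod (volume.restrict (Ioc a b))) := by
    rw [Measure.prod_restrict]
    exact (hS.continuousOn.integrableOn_compact
      ((isCompact_closedBall (0 : E) r).prod isCompact_Icc)).mono_set
      (prod_mono_right Ioc_subset_Icc_self)
  have hFint : ∀ t ∈ Icc a b, Integrable (F t) μ := fun t ht =>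
    integrable_of_eq_zero_of_norm_lt μ (hcont hF t) (hF0 t ht)
  have hFa := hFint a (left_mem_Icc.2 hab)
  have hFb := hFint b (right_mem_Icc.2 hab)
  rw [← sub_nonpos, ← integral_sub hFb hFa]
  calc ∫ x, (F b x - F a x) ∂μ
      ≤ ∫ x, (Metric.closedBall (0 : E) r).indicator
          (fun x => ∫ t in Ioc a b, ∑ i, D i t x) x ∂μ := by
        refine integral_mono (hFb.sub hFa) ?_ hpt
        exact (integrable_indicator_iff Metric.isClosed_closedBall.measurableSet).2
          hprod.integral_prod_left
    _ = ∫ t in Ioc a b, ∫ x in Metric.closedBall (0 : E) r, ∑ i, D i t x ∂μ := by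
        rw [integral_indicator Metric.isClosed_closedBall.measurableSet,
          integral_integral_swap hprod]
    _ = 0 := by
        refine setIntegral_eq_zero_of_forall_eq_zero fun t ht => ?_
        have ht' := Ioc_subset_Icc_self ht
        rw [setIntegral_eq_integral_of_forall_compl_eq_zero, hDint t ht']
        intro x hx
        exact Finset.sum_eq_zero fun i _ => hD0 i t ht' x (by simpa using hx)
    _ ≤ 0 := le_rfl

theorem eq_zero_of_integral_nonpos {E : Type*} [TopologicalSpace E] [MeasurableSpace E]
    (μ : Measure E) [μ.IsOpenPosMeasure] {f : E → ℝ} (hf : Continuous f) (hint : Integrable f μ)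
    (h0 : ∀ x, 0 ≤ f x) (h : ∫ x, f x ∂μ ≤ 0) (x : E) : f x = 0 := by
  have hae := (integral_eq_zero_iff_of_nonneg h0 hint).1 (le_antisymm h (integral_nonneg h0))
  exact congrFun ((hf.ae_eq_iff_eq μ continuous_zero).1 hae) x

/-- The partial derivative `∂ᵢu` in the `i`-th space variable. -/
def spaceDeriv (d : ℕ) (i : Fin d) (u : ℝ → Euc d → ℝ) (t : ℝ) (x : Euc d) : ℝ :=
  fderiv ℝ (u t) x (EuclideanSpace.single i 1)

section Derivatives

variable {d : ℕ} {u : ℝ → Euc d → ℝ}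

theorem hasDerivAt_time (hu : ContDiff ℝ (⊤ : ℕ∞) (Function.uncurry u)) (t : ℝ) (x : Euc d) :
    HasDerivAt (fun s => u s x) (fderiv ℝ (Function.uncurry u) (t, x) (1, 0)) t := by
  have h := (hu.differentiable (by simp) (t, x)).hasFDerivAt
  exact h.comp_hasDerivAt t ((hasDerivAt_id t).prodMk (hasDerivAt_const t x))

theorem timeDeriv_eq_fderiv (hu : ContDiff ℝ (⊤ : ℕ∞) (Function.uncurry u)) (t : ℝ) (x : Euc d) :
    timeDeriv d u t x = fderiv ℝ (Function.uncurry u) (t, x) (1, 0) :=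
  (hasDerivAt_time hu t x).deriv

theorem hasDerivAt_timeDeriv (hu : ContDiff ℝ (⊤ : ℕ∞) (Function.uncurry u)) (t : ℝ) (x : Euc d) :
    HasDerivAt (fun s => u s x) (timeDeriv d u t x) t := by
  rw [timeDeriv_eq_fderiv hu]
  exact hasDerivAt_time hu t x

theorem contDiff_slice (hu : ContDiff ℝ (⊤ : ℕ∞) (Function.uncurry u)) (t : ℝ) :
    ContDiff ℝ (⊤ : ℕ∞) (u t) :=
  hu.comp (contDiff_prodMk_right t)

theorem fderiv_slice (hu : ContDiff ℝ (⊤ : ℕ∞) (Function.uncurry u)) (t : ℝ) (x v : Euc d) :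
    fderiv ℝ (u t) x v = fderiv ℝ (Function.uncurry u) (t, x) (0, v) := by
  have h := (hu.differentiable (by simp) (t, x)).hasFDerivAt
  have h2 := h.comp x (hasFDerivAt_prodMk_right t x)
  exact congrArg (fun L => L v) h2.fderiv

theorem spaceDeriv_eq_fderiv (hu : ContDiff ℝ (⊤ : ℕ∞) (Function.uncurry u)) (i : Fin d)
    (t : ℝ) (x : Euc d) : spaceDeriv d i u t x =
      fderiv ℝ (Function.uncurry u) (t, x) (0, EuclideanSpace.single i 1) :=
  fderiv_slice hu t x _

theorem hasLineDerivAt_spaceDeriv (hu : ContDiff ℝ (⊤ : ℕ∞) (Function.uncurry u)) (i : Fin d)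
    (t : ℝ) (x : Euc d) :
    HasLineDerivAt ℝ (u t) (spaceDeriv d i u t x) x (EuclideanSpace.single i 1) :=
  (((contDiff_slice hu t).differentiable (by simp)) x).hasFDerivAt.hasLineDerivAt _

theorem contDiff_fderiv_apply {E : Type*} [NormedAddCommGroup E] [NormedSpace ℝ E] {f : E → ℝ}
    (hf : ContDiff ℝ (⊤ : ℕ∞) f) (v : E) : ContDiff ℝ (⊤ : ℕ∞) fun p => fderiv ℝ f p v :=
  (hf.fderiv_right (by simp)).clm_apply contDiff_const

theorem contDiff_timeDeriv (hu : ContDiff ℝ (⊤ : ℕ∞) (Function.uncurry u)) :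
    ContDiff ℝ (⊤ : ℕ∞) (Function.uncurry (timeDeriv d u)) := by
  convert contDiff_fderiv_apply hu (1, 0) using 1
  exact funext fun p => timeDeriv_eq_fderiv hu p.1 p.2

theorem contDiff_spaceDeriv (hu : ContDiff ℝ (⊤ : ℕ∞) (Function.uncurry u)) (i : Fin d) :
    ContDiff ℝ (⊤ : ℕ∞) (Function.uncurry (spaceDeriv d i u)) := by
  convert contDiff_fderiv_apply hu (0, EuclideanSpace.single i 1) using 1
  exact funext fun p => spaceDeriv_eq_fderiv hu i p.1 p.2

theorem fderiv_fderiv_apply_comm {E : Type*} [NormedAddCommGroup E] [NormedSpace ℝ E] {f : E → ℝ}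
    (hf : ContDiff ℝ (⊤ : ℕ∞) f) (p v w : E) :
    fderiv ℝ (fun q => fderiv ℝ f q v) p w = fderiv ℝ (fun q => fderiv ℝ f q w) p v := by
  have hd : DifferentiableAt ℝ (fderiv ℝ f) p :=
    (hf.fderiv_right (m := (⊤ : ℕ∞)) (by simp)).differentiable (by simp) p
  have hsymm : IsSymmSndFDerivAt ℝ f p := hf.contDiffAt.isSymmSndFDerivAt
    (by simpa using WithTop.coe_le_coe.2 (le_top : (2 : ℕ∞) ≤ ⊤))
  rw [fderiv_clm_apply hd (by fun_prop), fderiv_clm_apply hd (by fun_prop)]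
  simpa using hsymm w v

theorem timeDeriv_spaceDeriv_comm (hu : ContDiff ℝ (⊤ : ℕ∞) (Function.uncurry u)) (i : Fin d)
    (t : ℝ) (x : Euc d) :
    timeDeriv d (spaceDeriv d i u) t x = spaceDeriv d i (timeDeriv d u) t x := by
  rw [timeDeriv_eq_fderiv (contDiff_spaceDeriv hu i),
    spaceDeriv_eq_fderiv (contDiff_timeDeriv hu)]
  have h1 : Function.uncurry (spaceDeriv d i u) =
      fun p => fderiv ℝ (Function.uncurry u) p (0, EuclideanSpace.single i 1) :=
    funext fun p => spaceDeriv_eq_fderiv hu i p.1 p.2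
  have h2 : Function.uncurry (timeDeriv d u) =
      fun p => fderiv ℝ (Function.uncurry u) p (1, 0) :=
    funext fun p => timeDeriv_eq_fderiv hu p.1 p.2
  rw [h1, h2, fderiv_fderiv_apply_comm hu]

theorem spaceDeriv_spaceDeriv_comm (hu : ContDiff ℝ (⊤ : ℕ∞) (Function.uncurry u)) (i j : Fin d)
    (t : ℝ) (x : Euc d) :
    spaceDeriv d i (spaceDeriv d j u) t x = spaceDeriv d j (spaceDeriv d i u) t x :=
  fderiv_fderiv_apply_comm (contDiff_slice hu t) x _ _

/-- The radial quantity `x · ∇u` in coordinates. -/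
theorem inner_gradient_eq_sum (t : ℝ) (x y : Euc d) :
    ⟪y, gradient (u t) x⟫ = ∑ i, y i * spaceDeriv d i u t x := by
  rw [real_inner_comm, gradient, InnerProductSpace.toDual_symm_apply]
  conv_lhs => rw [← (EuclideanSpace.basisFun (Fin d) ℝ).sum_repr y]
  simp [spaceDeriv]

theorem norm_gradient_sq_eq_sum (t : ℝ) (x : Euc d) :
    ‖gradient (u t) x‖ ^ 2 = ∑ i, spaceDeriv d i u t x ^ 2 := by
  have h : ∀ i, gradient (u t) x i = spaceDeriv d i u t x := fun i => by
    have := inner_gradient_eq_sum (u := u) t x (EuclideanSpace.single i 1)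
    rw [EuclideanSpace.inner_single_left] at this
    simpa [Pi.single_apply] using this
  rw [EuclideanSpace.real_norm_sq_eq]
  simp [h]

theorem abs_sum_mul_spaceDeriv_le (t : ℝ) (x y : Euc d) :
    (∑ i, y i * spaceDeriv d i u t x) ^ 2 ≤ ‖y‖ ^ 2 * ∑ i, spaceDeriv d i u t x ^ 2 := by
  rw [← inner_gradient_eq_sum, ← norm_gradient_sq_eq_sum, ← mul_pow]
  exact sq_le_sq' (neg_le_of_abs_le (abs_real_inner_le_norm _ _)) (real_inner_le_norm _ _)

theorem spaceDeriv_eq_zero_of_norm_lt (hu : ContDiff ℝ (⊤ : ℕ∞) (Function.uncurry u)) {r t : ℝ}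
    (h : ∀ x, r < ‖x‖ → u t x = 0) (i : Fin d) {x : Euc d} (hx : r < ‖x‖) :
    spaceDeriv d i u t x = 0 :=
  (hasLineDerivAt_spaceDeriv hu i t x).eq_zero_of_norm_lt h hx

end Derivatives

/-- The potential energy density `(d-1)/(2(d+1)) |y|^{2(d+1)/(d-1)}`. -/
def potential (d : ℕ) (y : ℝ) : ℝ :=
  ((d : ℝ) - 1) / (2 * ((d : ℝ) + 1)) * |y| ^ (2 * ((d : ℝ) + 1) / ((d : ℝ) - 1))

/-- The energy density `(∂ₜu)²/2 + |∇u|²/2 + G(u)`. -/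
def energyDensity (d : ℕ) (u : ℝ → Euc d → ℝ) (t : ℝ) (x : Euc d) : ℝ :=
  (timeDeriv d u t x ^ 2 + ∑ j, spaceDeriv d j u t x ^ 2) / 2 + potential d (u t x)

/-- The density of the conserved quantity generated by the conformal multiplier. -/
def conformalDensity (d : ℕ) (u : ℝ → Euc d → ℝ) (t : ℝ) (x : Euc d) : ℝ :=
  (t ^ 2 + ‖x‖ ^ 2) * energyDensity d u t x
    + 2 * t * (∑ j, x j * spaceDeriv d j u t x) * timeDeriv d u t x
    + ((d : ℝ) - 1) * t * (u t x * timeDeriv d u t x)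
    + ((d : ℝ) - 1) * (∑ j, x j * spaceDeriv d j u t x) * u t x
    + ((d : ℝ) - 1) ^ 2 / 2 * u t x ^ 2

/-- The flux of `conformalDensity`. -/
def conformalFlux (d : ℕ) (u : ℝ → Euc d → ℝ) (i : Fin d) (t : ℝ) (x : Euc d) : ℝ :=
  (t ^ 2 + ‖x‖ ^ 2) * (timeDeriv d u t x * spaceDeriv d i u t x)
    + t * (x i * timeDeriv d u t x ^ 2)
    + 2 * t * ((∑ j, x j * spaceDeriv d j u t x) * spaceDeriv d i u t x)
    - t * (x i * ∑ j, spaceDeriv d j u t x ^ 2)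
    + ((d : ℝ) - 1) * t * (u t x * spaceDeriv d i u t x)
    - 2 * t * (x i * potential d (u t x))
    + ((d : ℝ) - 1) * (x i * (u t x * timeDeriv d u t x))

/-- The `i`-th partial derivative of the `i`-th component of `conformalFlux`. -/
def conformalFluxDeriv (d : ℕ) (u : ℝ → Euc d → ℝ) (i : Fin d) (t : ℝ) (x : Euc d) : ℝ :=
  2 * x i * (timeDeriv d u t x * spaceDeriv d i u t x)
    + (t ^ 2 + ‖x‖ ^ 2) * (spaceDeriv d i (timeDeriv d u) t x * spaceDeriv d i u t x
      + timeDeriv d u t x * spaceDeriv d i (spaceDeriv d i u) t x)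
    + t * (timeDeriv d u t x ^ 2
      + x i * (2 * timeDeriv d u t x * spaceDeriv d i (timeDeriv d u) t x))
    + 2 * t * ((spaceDeriv d i u t x + ∑ j, x j * spaceDeriv d i (spaceDeriv d j u) t x)
        * spaceDeriv d i u t x
      + (∑ j, x j * spaceDeriv d j u t x) * spaceDeriv d i (spaceDeriv d i u) t x)
    - t * (∑ j, spaceDeriv d j u t x ^ 2
      + x i * ∑ j, 2 * spaceDeriv d j u t x * spaceDeriv d i (spaceDeriv d j u) t x)
    + ((d : ℝ) - 1) * t * (spaceDeriv d i u t x ^ 2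
      + u t x * spaceDeriv d i (spaceDeriv d i u) t x)
    - 2 * t * (potential d (u t x)
      + x i * (|u t x| ^ ((4 : ℝ) / ((d : ℝ) - 1)) * u t x * spaceDeriv d i u t x))
    + ((d : ℝ) - 1) * (u t x * timeDeriv d u t x
      + x i * (spaceDeriv d i u t x * timeDeriv d u t x
        + u t x * spaceDeriv d i (timeDeriv d u) t x))

section Energy

variable {d : ℕ} {u : ℝ → Euc d → ℝ}

theorem one_lt_conformal_exponent (hd : 2 ≤ d) :
    1 < 2 * ((d : ℝ) + 1) / ((d : ℝ) - 1) := by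
  have h : (2 : ℝ) ≤ d := by exact_mod_cast hd
  rw [lt_div_iff₀ (by linarith)]
  linarith

theorem hasDerivAt_potential (hd : 2 ≤ d) (y : ℝ) :
    HasDerivAt (potential d) (|y| ^ ((4 : ℝ) / ((d : ℝ) - 1)) * y) y := by
  have h : (2 : ℝ) ≤ d := by exact_mod_cast hd
  have h1 : (d : ℝ) - 1 ≠ 0 := by linarith
  have h2 : (d : ℝ) + 1 ≠ 0 := by linarith
  refine ((hasDerivAt_abs_rpow y (one_lt_conformal_exponent hd)).const_mul
    (((d : ℝ) - 1) / (2 * ((d : ℝ) + 1)))).congr_deriv ?_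
  have h3 : 2 * ((d : ℝ) + 1) / ((d : ℝ) - 1) - 2 = 4 / ((d : ℝ) - 1) := by
    field_simp; ring
  rw [h3]
  field_simp

theorem continuous_potential (hd : 2 ≤ d) : Continuous (potential d) :=
  continuous_iff_continuousAt.2 fun y => (hasDerivAt_potential hd y).continuousAt

theorem potential_nonneg (hd : 2 ≤ d) (y : ℝ) : 0 ≤ potential d y := by
  have h : (2 : ℝ) ≤ d := by exact_mod_cast hd
  have : 0 ≤ (d : ℝ) - 1 := by linarith
  unfold potential
  positivity

theorem potential_zero (hd : 2 ≤ d) : potential d 0 = 0 := by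
  have := one_lt_conformal_exponent hd
  simp only [potential, abs_zero]
  rw [Real.zero_rpow (by linarith), mul_zero]

theorem hasLineDerivAt_coord (x : Euc d) (i j : Fin d) :
    HasLineDerivAt ℝ (fun y : Euc d => y j) (if i = j then 1 else 0) x
      (EuclideanSpace.single i 1) := by
  have := ((EuclideanSpace.proj j : Euc d →L[ℝ] ℝ).hasFDerivAt (x := x)).hasLineDerivAt
    (EuclideanSpace.single i 1)
  simpa [Pi.single_apply, eq_comm] using this

theorem hasLineDerivAt_norm_sq (x : Euc d) (i : Fin d) :
    HasLineDerivAt ℝ (fun y : Euc d => ‖y‖ ^ 2) (2 * x i) x (EuclideanSpace.single i 1) := by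
  have := ((hasStrictFDerivAt_norm_sq x).hasFDerivAt).hasLineDerivAt (EuclideanSpace.single i 1)
  simpa [EuclideanSpace.inner_single_right] using this

theorem hasLineDerivAt_conformalFlux (hd : 2 ≤ d)
    (hu : ContDiff ℝ (⊤ : ℕ∞) (Function.uncurry u)) (i : Fin d) (t : ℝ) (x : Euc d) :
    HasLineDerivAt ℝ (conformalFlux d u i t) (conformalFluxDeriv d u i t x) x
      (EuclideanSpace.single i 1) := by
  have hut := contDiff_timeDeriv hu
  have hux := contDiff_spaceDeriv hu
  have Hu := hasLineDerivAt_spaceDeriv hu i t x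
  have Ht := hasLineDerivAt_spaceDeriv hut i t x
  have Hi := fun j => hasLineDerivAt_spaceDeriv (hux j) i t x
  have Hx := hasLineDerivAt_coord x i
  have HR := hasLineDerivAt_norm_sq x i
  have HG := (hasDerivAt_potential hd (u t x)).comp_of_eq 0 Hu (by simp)
  unfold HasLineDerivAt at *
  have Hs := HasDerivAt.fun_sum (u := Finset.univ) fun j _ => (Hx j).fun_mul (Hi j)
  have HN := HasDerivAt.fun_sum (u := Finset.univ) fun j _ => (Hi j).fun_pow 2
  have key := (((((((HR.const_add (t ^ 2)).mul (Ht.mul (Hi i))).add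
    (((Hx i).mul (Ht.pow 2)).const_mul t)).add
    ((Hs.mul (Hi i)).const_mul (2 * t))).sub
    (((Hx i).mul HN).const_mul t)).add
    ((Hu.mul (Hi i)).const_mul (((d : ℝ) - 1) * t))).sub
    (((Hx i).mul HG).const_mul (2 * t))).add
    (((Hx i).mul (Hu.mul Ht)).const_mul ((d : ℝ) - 1))
  refine key.congr_deriv ?_
  simp [conformalFluxDeriv, Finset.sum_add_distrib, -mul_eq_mul_left_iff, -add_left_inj,
    -add_right_inj, -sub_left_inj, -sub_right_inj]
  ring

theorem hasDerivAt_energyDensity (hd : 2 ≤ d)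
    (hu : ContDiff ℝ (⊤ : ℕ∞) (Function.uncurry u)) (t : ℝ) (x : Euc d) :
    HasDerivAt (fun s => energyDensity d u s x)
      (timeDeriv d u t x * timeDeriv2 d u t x
        + ∑ j, spaceDeriv d j u t x * spaceDeriv d j (timeDeriv d u) t x
        + |u t x| ^ ((4 : ℝ) / ((d : ℝ) - 1)) * u t x * timeDeriv d u t x) t := by
  have hut := contDiff_timeDeriv hu
  have hux := contDiff_spaceDeriv hu
  have Hu := hasDerivAt_timeDeriv hu t x
  have Ht := hasDerivAt_timeDeriv hut t x
  have Hi := fun j => hasDerivAt_timeDeriv (hux j) t x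
  have HG := (hasDerivAt_potential hd (u t x)).comp t Hu
  have HN := HasDerivAt.fun_sum (u := Finset.univ) fun j _ => (Hi j).fun_pow 2
  refine ((((Ht.pow 2).add HN).div_const 2).add HG).congr_deriv ?_
  simp only [timeDeriv_spaceDeriv_comm hu, Nat.cast_ofNat, Nat.add_one_sub_one, pow_one,
    mul_assoc, ← Finset.mul_sum]
  simp only [timeDeriv, timeDeriv2]
  ring

theorem sum_conformalFlux_terms {ι : Type*} [Fintype ι] (x p a h A B : ι → ℝ)
    (t R v w s N G f c : ℝ) :
    ∑ i, (2 * x i * (v * p i) + R * (a i * p i + v * h i) + t * (v ^ 2 + x i * (2 * v * a i))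
      + 2 * t * ((p i + A i) * p i + s * h i) - t * (N + x i * (2 * B i))
      + c * t * (p i ^ 2 + w * h i) - 2 * t * (G + x i * (f * p i))
      + c * (w * v + x i * (p i * v + w * a i))) =
    2 * v * ∑ i, x i * p i + R * (∑ i, p i * a i + v * ∑ i, h i)
      + t * (Fintype.card ι * v ^ 2 + 2 * v * ∑ i, x i * a i)
      + 2 * t * (∑ i, p i ^ 2 + ∑ i, A i * p i + s * ∑ i, h i)
      - t * (Fintype.card ι * N + 2 * ∑ i, x i * B i)
      + c * t * (∑ i, p i ^ 2 + w * ∑ i, h i)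
      - 2 * t * (Fintype.card ι * G + f * ∑ i, x i * p i)
      + c * (Fintype.card ι * (w * v) + v * ∑ i, x i * p i + w * ∑ i, x i * a i) := by
  have hc : ∀ y : ℝ, (Fintype.card ι : ℝ) * y = ∑ _i : ι, y := fun y => by simp
  simp only [hc, Finset.mul_sum, ← Finset.sum_add_distrib, ← Finset.sum_sub_distrib]
  exact Finset.sum_congr rfl fun i _ => by ring

theorem hasDerivAt_conformalDensity (hd : 2 ≤ d)
    (hu : ContDiff ℝ (⊤ : ℕ∞) (Function.uncurry u)) (t : ℝ) (x : Euc d)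
    (heq : timeDeriv2 d u t x - spatialLap d (u t) x
      + |u t x| ^ ((4 : ℝ) / ((d : ℝ) - 1)) * u t x = 0) :
    HasDerivAt (fun s => conformalDensity d u s x) (∑ i, conformalFluxDeriv d u i t x) t := by
  have h2d : (2 : ℝ) ≤ d := by exact_mod_cast hd
  have hut := contDiff_timeDeriv hu
  have hux := contDiff_spaceDeriv hu
  have Hu := hasDerivAt_timeDeriv hu t x
  have Ht : HasDerivAt (fun s => timeDeriv d u s x) (timeDeriv2 d u t x) t :=
    hasDerivAt_timeDeriv hut t x
  have Hi := fun j => hasDerivAt_timeDeriv (hux j) t x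
  have He := hasDerivAt_energyDensity hd hu t x
  have Hs := HasDerivAt.fun_sum (u := Finset.univ) fun j _ => (Hi j).const_mul (x j)
  have h1 := hasDerivAt_id t
  have key := ((((((h1.pow 2).add_const (‖x‖ ^ 2)).mul He).add
    (((h1.const_mul 2).mul Hs).mul Ht)).add
    ((h1.const_mul ((d : ℝ) - 1)).mul (Hu.mul Ht))).add
    ((Hs.const_mul ((d : ℝ) - 1)).mul Hu)).add
    ((Hu.pow 2).const_mul (((d : ℝ) - 1) ^ 2 / 2))
  refine key.congr_deriv ?_
  have hQ : ∑ i, (∑ j, x j * spaceDeriv d i (spaceDeriv d j u) t x) * spaceDeriv d i u t x =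
      ∑ i, x i * ∑ j, spaceDeriv d j u t x * spaceDeriv d i (spaceDeriv d j u) t x := by
    simp only [Finset.mul_sum, Finset.sum_mul]
    rw [Finset.sum_comm]
    refine Finset.sum_congr rfl fun i _ => Finset.sum_congr rfl fun j _ => ?_
    rw [spaceDeriv_spaceDeriv_comm hu i j]
    ring
  have hL : timeDeriv2 d u t x = ∑ i, spaceDeriv d i (spaceDeriv d i u) t x -
      |u t x| ^ ((4 : ℝ) / ((d : ℝ) - 1)) * u t x := by
    have : spatialLap d (u t) x = ∑ i, spaceDeriv d i (spaceDeriv d i u) t x := rfl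
    linarith
  have hG : (((d : ℝ) - 1)) * (|u t x| ^ ((4 : ℝ) / ((d : ℝ) - 1)) * u t x ^ 2) =
      2 * ((d : ℝ) + 1) * potential d (u t x) := by
    have h1 : (d : ℝ) - 1 ≠ 0 := by linarith
    have h2 : (d : ℝ) + 1 ≠ 0 := by linarith
    have h3 : 2 * ((d : ℝ) + 1) / ((d : ℝ) - 1) = 4 / ((d : ℝ) - 1) + (2 : ℕ) := by
      field_simp; push_cast; ring
    have h4 : 0 ≤ 4 / ((d : ℝ) - 1) := div_nonneg (by norm_num) (by linarith)
    rw [potential, h3, Real.rpow_add_of_nonneg (abs_nonneg _) h4 (by positivity),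
      Real.rpow_natCast, sq_abs]
    field_simp
  have hdiv : ∑ i, conformalFluxDeriv d u i t x =
      2 * timeDeriv d u t x * ∑ i, x i * spaceDeriv d i u t x
      + (t ^ 2 + ‖x‖ ^ 2) * (∑ i, spaceDeriv d i u t x * spaceDeriv d i (timeDeriv d u) t x
        + timeDeriv d u t x * ∑ i, spaceDeriv d i (spaceDeriv d i u) t x)
      + t * (d * timeDeriv d u t x ^ 2
        + 2 * timeDeriv d u t x * ∑ i, x i * spaceDeriv d i (timeDeriv d u) t x)
      + 2 * t * (∑ i, spaceDeriv d i u t x ^ 2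
        + ∑ i, (∑ j, x j * spaceDeriv d i (spaceDeriv d j u) t x) * spaceDeriv d i u t x
        + (∑ j, x j * spaceDeriv d j u t x) * ∑ i, spaceDeriv d i (spaceDeriv d i u) t x)
      - t * (d * ∑ j, spaceDeriv d j u t x ^ 2
        + 2 * ∑ i, x i * ∑ j, spaceDeriv d j u t x * spaceDeriv d i (spaceDeriv d j u) t x)
      + ((d : ℝ) - 1) * t * (∑ i, spaceDeriv d i u t x ^ 2
        + u t x * ∑ i, spaceDeriv d i (spaceDeriv d i u) t x)
      - 2 * t * (d * potential d (u t x)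
        + |u t x| ^ ((4 : ℝ) / ((d : ℝ) - 1)) * u t x * ∑ i, x i * spaceDeriv d i u t x)
      + ((d : ℝ) - 1) * (d * (u t x * timeDeriv d u t x)
        + timeDeriv d u t x * ∑ i, x i * spaceDeriv d i u t x
        + u t x * ∑ i, x i * spaceDeriv d i (timeDeriv d u) t x) := by
    simp only [conformalFluxDeriv]
    have h := sum_conformalFlux_terms x (fun i => spaceDeriv d i u t x)
      (fun i => spaceDeriv d i (timeDeriv d u) t x)
      (fun i => spaceDeriv d i (spaceDeriv d i u) t x)
      (fun i => ∑ j, x j * spaceDeriv d i (spaceDeriv d j u) t x)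
      (fun i => ∑ j, spaceDeriv d j u t x * spaceDeriv d i (spaceDeriv d j u) t x)
      t (t ^ 2 + ‖x‖ ^ 2) (timeDeriv d u t x) (u t x) (∑ j, x j * spaceDeriv d j u t x)
      (∑ j, spaceDeriv d j u t x ^ 2) (potential d (u t x))
      (|u t x| ^ ((4 : ℝ) / ((d : ℝ) - 1)) * u t x) ((d : ℝ) - 1)
    rw [Fintype.card_fin] at h
    rw [← h]
    simp only [Finset.mul_sum, mul_assoc]
  rw [hdiv, hQ, hL]
  simp only [energyDensity, Pi.mul_apply, Pi.pow_apply, id]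
  simp only [timeDeriv_spaceDeriv_comm hu]
  linear_combination -t * hG

theorem energyDensity_nonneg (hd : 2 ≤ d) (t : ℝ) (x : Euc d) : 0 ≤ energyDensity d u t x := by
  have := potential_nonneg hd (u t x)
  have := Finset.sum_nonneg fun (j : Fin d) (_ : j ∈ Finset.univ) =>
    sq_nonneg (spaceDeriv d j u t x)
  unfold energyDensity
  positivity

theorem eq_zero_of_potential_eq_zero (hd : 2 ≤ d) {y : ℝ} (h : potential d y = 0) : y = 0 := by
  have h2d : (2 : ℝ) ≤ d := by exact_mod_cast hd
  by_contra hy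
  have h1 : 0 < (d : ℝ) - 1 := by linarith
  have h2 : 0 < |y| := abs_pos.2 hy
  have : 0 < potential d y := by unfold potential; positivity
  exact this.ne' h

theorem eq_zero_of_energyDensity_eq_zero (hd : 2 ≤ d) {t : ℝ} {x : Euc d}
    (h : energyDensity d u t x = 0) :
    u t x = 0 ∧ timeDeriv d u t x = 0 ∧ ∀ i, spaceDeriv d i u t x = 0 := by
  have h1 := potential_nonneg hd (u t x)
  have h2 := Finset.sum_nonneg fun (j : Fin d) (_ : j ∈ Finset.univ) =>
    sq_nonneg (spaceDeriv d j u t x)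
  have h3 := sq_nonneg (timeDeriv d u t x)
  unfold energyDensity at h
  refine ⟨eq_zero_of_potential_eq_zero hd (by linarith), pow_eq_zero_iff (two_ne_zero) |>.1
    (by linarith), fun i => ?_⟩
  have h4 : ∑ j, spaceDeriv d j u t x ^ 2 = 0 := by linarith
  rw [Finset.sum_eq_zero_iff_of_nonneg fun j _ => sq_nonneg _] at h4
  exact pow_eq_zero_iff two_ne_zero |>.1 (h4 i (Finset.mem_univ i))

theorem energyDensity_eq_zero (hd : 2 ≤ d) {t : ℝ} {x : Euc d} (h0 : u t x = 0)
    (h1 : timeDeriv d u t x = 0) (h2 : ∀ i, spaceDeriv d i u t x = 0) :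
    energyDensity d u t x = 0 := by
  simp [energyDensity, h0, h1, h2, potential_zero hd]

/-- A nonnegative `C¹` cutoff, positive exactly on the positive reals. -/
def cubicCutoff (y : ℝ) : ℝ := |y| ^ (3 : ℝ) + y ^ 3

theorem hasDerivAt_cubicCutoff (y : ℝ) :
    HasDerivAt cubicCutoff (3 * (|y| * y + y ^ 2)) y := by
  refine ((hasDerivAt_abs_rpow y (p := 3) (by norm_num)).add (hasDerivAt_pow 3 y)).congr_deriv ?_
  norm_num
  ring

theorem continuous_cubicCutoff : Continuous cubicCutoff :=
  continuous_iff_continuousAt.2 fun y => (hasDerivAt_cubicCutoff y).continuousAt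

theorem cubicCutoff_of_nonpos {y : ℝ} (hy : y ≤ 0) : cubicCutoff y = 0 := by
  have : |y| ^ (3 : ℝ) = |y| ^ 3 := by exact_mod_cast Real.rpow_natCast |y| 3
  rw [cubicCutoff, this, abs_of_nonpos hy]
  ring

theorem cubicCutoff_pos {y : ℝ} (hy : 0 < y) : 0 < cubicCutoff y := by
  unfold cubicCutoff
  positivity

theorem cubicCutoff_nonneg (y : ℝ) : 0 ≤ cubicCutoff y := by
  rcases le_or_gt y 0 with h | h
  · exact (cubicCutoff_of_nonpos h).ge
  · exact (cubicCutoff_pos h).le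

/-- The energy flux through a backward light cone points outward. -/
theorem mul_sum_le_energyDensity (hd : 2 ≤ d) {τ t : ℝ} {x y : Euc d} (hy : ‖y‖ ^ 2 ≤ τ ^ 2)
    (hτ : 0 ≤ τ) : timeDeriv d u t x * ∑ i, y i * spaceDeriv d i u t x ≤
      τ * energyDensity d u t x := by
  have hS := abs_sum_mul_spaceDeriv_le (u := u) t x y
  have hG := potential_nonneg hd (u t x)
  have hN := Finset.sum_nonneg fun (j : Fin d) (_ : j ∈ Finset.univ) =>
    sq_nonneg (spaceDeriv d j u t x)
  unfold energyDensity
  set S := ∑ i, y i * spaceDeriv d i u t x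
  set N := ∑ j, spaceDeriv d j u t x ^ 2
  set v := timeDeriv d u t x
  have h1 : S ^ 2 ≤ (τ * √N) ^ 2 := by
    rw [mul_pow, Real.sq_sqrt hN]
    exact hS.trans (by gcongr)
  have h2 : |S| ≤ τ * √N := abs_le_of_sq_le_sq h1 (by positivity)
  have h3 : v * S ≤ |v| * (τ * √N) :=
    (le_abs_self _).trans (by rw [abs_mul]; gcongr)
  have h4 : |v| * √N ≤ (v ^ 2 + N) / 2 := by
    nlinarith [sq_nonneg (|v| - √N), Real.sq_sqrt hN, sq_abs v]
  nlinarith [mul_le_mul_of_nonneg_left h4 hτ, mul_nonneg hτ hG]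

theorem continuous_curried {α β : Type*} [TopologicalSpace α] [TopologicalSpace β]
    {g : α → β → ℝ} (h : Continuous (Function.uncurry g)) : Continuous fun p : α × β => g p.1 p.2 := h

theorem continuous_energyDensity (hd : 2 ≤ d)
    (hu : ContDiff ℝ (⊤ : ℕ∞) (Function.uncurry u)) :
    Continuous (Function.uncurry (energyDensity d u)) := by
  have h1 := continuous_curried (contDiff_timeDeriv hu).continuous
  have h2 := fun i => continuous_curried (contDiff_spaceDeriv hu i).continuous
  have h3 := (continuous_potential hd).comp (continuous_curried hu.continuous)
  exact (((h1.pow 2).add (continuous_finsetSum _ fun i _ => (h2 i).pow 2)).div_const 2).add h3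

/-- A weight supported in the backward light cone with apex `(R, x₀)`. -/
def coneWeight (R : ℝ) (x₀ : Euc d) (t : ℝ) (x : Euc d) : ℝ :=
  cubicCutoff ((R - t) ^ 2 - ‖x - x₀‖ ^ 2)

/-- The factor in the derivatives of `coneWeight` coming from the cutoff. -/
def coneWeightDeriv (R : ℝ) (x₀ : Euc d) (t : ℝ) (x : Euc d) : ℝ :=
  3 * (|(R - t) ^ 2 - ‖x - x₀‖ ^ 2| * ((R - t) ^ 2 - ‖x - x₀‖ ^ 2)
    + ((R - t) ^ 2 - ‖x - x₀‖ ^ 2) ^ 2)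

theorem continuous_coneWeight (R : ℝ) (x₀ : Euc d) :
    Continuous (Function.uncurry (coneWeight R x₀)) := by
  have : Continuous fun p : ℝ × Euc d => (R - p.1) ^ 2 - ‖p.2 - x₀‖ ^ 2 := by fun_prop
  exact continuous_cubicCutoff.comp this

theorem continuous_coneWeightDeriv (R : ℝ) (x₀ : Euc d) :
    Continuous (Function.uncurry (coneWeightDeriv R x₀)) := by
  unfold coneWeightDeriv Function.uncurry
  fun_prop

theorem hasDerivAt_coneWeight (R : ℝ) (x₀ : Euc d) (t : ℝ) (x : Euc d) :
    HasDerivAt (fun s => coneWeight R x₀ s x) (coneWeightDeriv R x₀ t x * (-2 * (R - t))) t := by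
  have h : HasDerivAt (fun s => (R - s) ^ 2 - ‖x - x₀‖ ^ 2) (-2 * (R - t)) t :=
    ((((hasDerivAt_id t).const_sub R).pow 2).sub_const _).congr_deriv (by simp)
  exact (hasDerivAt_cubicCutoff _).comp t h

theorem hasLineDerivAt_coneWeight (R : ℝ) (x₀ : Euc d) (i : Fin d) (t : ℝ) (x : Euc d) :
    HasLineDerivAt ℝ (coneWeight R x₀ t) (coneWeightDeriv R x₀ t x * (-2 * (x - x₀) i)) x
      (EuclideanSpace.single i 1) := by
  have h := hasLineDerivAt_norm_sq (x - x₀) i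
  unfold HasLineDerivAt at *
  simp only [sub_add_eq_add_sub] at h
  have h' := (h.const_sub ((R - t) ^ 2)).congr_deriv (neg_mul_eq_neg_mul _ _)
  exact (hasDerivAt_cubicCutoff _).comp_of_eq 0 h' (by simp)

theorem coneWeight_nonneg (R : ℝ) (x₀ : Euc d) (t : ℝ) (x : Euc d) : 0 ≤ coneWeight R x₀ t x :=
  cubicCutoff_nonneg _

theorem coneWeight_pos {R t : ℝ} (x₀ : Euc d) (ht : t < R) : 0 < coneWeight R x₀ t x₀ := by
  refine cubicCutoff_pos ?_
  rw [sub_self, norm_zero]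
  linarith [pow_pos (sub_pos.2 ht) 2]

theorem coneWeight_eq_zero {R t : ℝ} {x₀ x : Euc d} (ht : t ≤ R) (hx : R - t ≤ ‖x - x₀‖) :
    coneWeight R x₀ t x = 0 :=
  cubicCutoff_of_nonpos (sub_nonpos.2 (pow_le_pow_left₀ (by linarith) hx 2))

theorem coneWeight_eq_zero_of_lt_norm {a R t : ℝ} {x₀ x : Euc d} (ha : a ≤ t) (ht : t ≤ R)
    (hx : ‖x₀‖ + (R - a) < ‖x‖) : coneWeight R x₀ t x = 0 := by
  refine coneWeight_eq_zero ht ?_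
  have := norm_sub_norm_le x x₀
  linarith

theorem coneWeightDeriv_mul_flux_nonneg (hd : 2 ≤ d) {R t : ℝ} (x₀ x : Euc d) (ht : t ≤ R) :
    0 ≤ coneWeightDeriv R x₀ t x * ((R - t) * energyDensity d u t x
      - timeDeriv d u t x * ∑ i, (x - x₀) i * spaceDeriv d i u t x) := by
  unfold coneWeightDeriv
  rcases le_or_gt ((R - t) ^ 2 - ‖x - x₀‖ ^ 2) 0 with h | h
  · rw [abs_of_nonpos h]
    exact le_of_eq (by ring)
  · refine mul_nonneg (by positivity) (sub_nonneg.2 (mul_sum_le_energyDensity hd ?_ ?_))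
    · exact (sub_pos.1 h).le
    · linarith

theorem integral_coneWeight_mul_energyDensity_le (hd : 2 ≤ d)
    (hu : ContDiff ℝ (⊤ : ℕ∞) (Function.uncurry u))
    (heq : ∀ t x, timeDeriv2 d u t x - spatialLap d (u t) x
      + |u t x| ^ ((4 : ℝ) / ((d : ℝ) - 1)) * u t x = 0)
    {a T R : ℝ} (haT : a ≤ T) (hTR : T ≤ R) (x₀ : Euc d) :
    ∫ x, coneWeight R x₀ T x * energyDensity d u T x ≤
      ∫ x, coneWeight R x₀ a x * energyDensity d u a x := by
  have hut := contDiff_timeDeriv hu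
  have hux := contDiff_spaceDeriv hu
  have hWc := continuous_coneWeight R x₀
  have hFt := fun t x => (hasDerivAt_coneWeight R x₀ t x).fun_mul
    (hasDerivAt_energyDensity hd hu t x)
  have hVx : ∀ i t x, HasLineDerivAt ℝ
      (fun x => coneWeight R x₀ t x * (timeDeriv d u t x * spaceDeriv d i u t x))
      (coneWeightDeriv R x₀ t x * (-2 * (x - x₀) i) * (timeDeriv d u t x * spaceDeriv d i u t x)
        + coneWeight R x₀ t x * (spaceDeriv d i (timeDeriv d u) t x * spaceDeriv d i u t x
          + timeDeriv d u t x * spaceDeriv d i (spaceDeriv d i u) t x)) x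
      (EuclideanSpace.single i 1) := by
    intro i t x
    have h1 := hasLineDerivAt_coneWeight R x₀ i t x
    have h2 := hasLineDerivAt_spaceDeriv hut i t x
    have h3 := hasLineDerivAt_spaceDeriv (hux i) i t x
    unfold HasLineDerivAt at *
    refine (h1.fun_mul (h2.fun_mul h3)).congr_deriv ?_
    simp
  have hVc : ∀ i, Continuous (Function.uncurry fun t x =>
      coneWeight R x₀ t x * (timeDeriv d u t x * spaceDeriv d i u t x)) := fun i =>
    hWc.mul (hut.continuous.mul (hux i).continuous)
  have hDc : ∀ i, Continuous (Function.uncurry fun t x =>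
      coneWeightDeriv R x₀ t x * (-2 * (x - x₀) i) * (timeDeriv d u t x * spaceDeriv d i u t x)
        + coneWeight R x₀ t x * (spaceDeriv d i (timeDeriv d u) t x * spaceDeriv d i u t x
          + timeDeriv d u t x * spaceDeriv d i (spaceDeriv d i u) t x)) := by
    intro i
    have h : Continuous fun p : ℝ × Euc d => -2 * (p.2 - x₀) i := by fun_prop
    exact (((continuous_coneWeightDeriv R x₀).mul h).mul
      (hut.continuous.mul (hux i).continuous)).add
      (hWc.mul (((contDiff_spaceDeriv hut i).continuous.mul (hux i).continuous).add
        (hut.continuous.mul (contDiff_spaceDeriv (hux i) i).continuous)))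
  have hFc : Continuous (Function.uncurry fun t x =>
      coneWeight R x₀ t x * energyDensity d u t x) :=
    hWc.mul (continuous_energyDensity hd hu)
  refine integral_le_of_deriv_le_divergence (volume : Measure (Euc d)) haT
    (r := ‖x₀‖ + (R - a)) hFc hFt hVc hDc hVx
    (fun t ht x hx => ?_) (fun i t ht x hx => ?_) (fun t ht x => ?_)
  · rw [coneWeight_eq_zero_of_lt_norm ht.1 (ht.2.trans hTR) hx, zero_mul]
  · rw [coneWeight_eq_zero_of_lt_norm ht.1 (ht.2.trans hTR) hx, zero_mul]
  have hL : timeDeriv2 d u t x = ∑ i, spaceDeriv d i (spaceDeriv d i u) t x -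
      |u t x| ^ ((4 : ℝ) / ((d : ℝ) - 1)) * u t x := by
    have : spatialLap d (u t) x = ∑ i, spaceDeriv d i (spaceDeriv d i u) t x := rfl
    linarith [heq t x]
  have hsum : ∀ A W v : ℝ, ∑ i, (A * (-2 * (x - x₀) i) * (v * spaceDeriv d i u t x)
      + W * (spaceDeriv d i (timeDeriv d u) t x * spaceDeriv d i u t x
        + v * spaceDeriv d i (spaceDeriv d i u) t x)) =
      -2 * A * (v * ∑ i, (x - x₀) i * spaceDeriv d i u t x)
      + W * (∑ i, spaceDeriv d i u t x * spaceDeriv d i (timeDeriv d u) t x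
        + v * ∑ i, spaceDeriv d i (spaceDeriv d i u) t x) := fun A W v => by
    simp only [Finset.mul_sum, ← Finset.sum_add_distrib]
    exact Finset.sum_congr rfl fun i _ => by ring
  have hflux := coneWeightDeriv_mul_flux_nonneg (u := u) hd x₀ x (ht.2.le.trans hTR)
  rw [hsum, hL]
  linarith

/-- Finite speed of propagation. -/
theorem energyDensity_eq_zero_of_lt (hd : 2 ≤ d)
    (hu : ContDiff ℝ (⊤ : ℕ∞) (Function.uncurry u))
    (heq : ∀ t x, timeDeriv2 d u t x - spatialLap d (u t) x
      + |u t x| ^ ((4 : ℝ) / ((d : ℝ) - 1)) * u t x = 0)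
    {a M T : ℝ} (haT : a ≤ T) (h0 : ∀ x, M < ‖x‖ → energyDensity d u a x = 0) {x₀ : Euc d}
    (hx₀ : M + (T - a) < ‖x₀‖) : energyDensity d u T x₀ = 0 := by
  obtain ⟨R, hR⟩ : ∃ R, R = ‖x₀‖ - M + a := ⟨_, rfl⟩
  have hTR : T < R := by linarith
  have hmono := integral_coneWeight_mul_energyDensity_le hd hu heq haT hTR.le x₀
  have hzero : ∀ x, coneWeight R x₀ a x * energyDensity d u a x = 0 := by
    intro x
    rcases le_or_gt ‖x‖ M with h | h
    · rw [coneWeight_eq_zero (by linarith), zero_mul]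
      have := norm_sub_norm_le x₀ x
      rw [norm_sub_rev] at this
      linarith
    · rw [h0 x h, mul_zero]
  simp only [hzero, integral_zero] at hmono
  have hFc : Continuous (Function.uncurry fun t x =>
      coneWeight R x₀ t x * energyDensity d u t x) :=
    (continuous_coneWeight R x₀).mul (continuous_energyDensity hd hu)
  have hFT : Continuous fun x => coneWeight R x₀ T x * energyDensity d u T x := hFc.uncurry_left T
  have hsupp : ∀ x, ‖x₀‖ + (R - a) < ‖x‖ → coneWeight R x₀ T x * energyDensity d u T x = 0 :=
    fun x hx => by rw [coneWeight_eq_zero_of_lt_norm haT hTR.le hx, zero_mul]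
  have h := eq_zero_of_integral_nonpos volume hFT
    (integrable_of_eq_zero_of_norm_lt volume hFT hsupp) (fun x =>
    mul_nonneg (coneWeight_nonneg _ _ _ _) (energyDensity_nonneg hd T x)) hmono x₀
  exact (mul_eq_zero.1 h).resolve_left (coneWeight_pos x₀ hTR).ne'

theorem continuous_sum_mul_spaceDeriv (hu : ContDiff ℝ (⊤ : ℕ∞) (Function.uncurry u)) :
    Continuous fun p : ℝ × Euc d => ∑ j, p.2 j * spaceDeriv d j u p.1 p.2 := by
  have h := fun i => continuous_curried (contDiff_spaceDeriv hu i).continuous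
  fun_prop

theorem continuous_conformalDensity (hd : 2 ≤ d)
    (hu : ContDiff ℝ (⊤ : ℕ∞) (Function.uncurry u)) :
    Continuous (Function.uncurry (conformalDensity d u)) := by
  have h0 := continuous_curried hu.continuous
  have h1 := continuous_curried (contDiff_timeDeriv hu).continuous
  have h2 := continuous_sum_mul_spaceDeriv hu
  have h3 := continuous_curried (continuous_energyDensity hd hu)
  unfold conformalDensity Function.uncurry
  fun_prop

theorem continuous_conformalFlux (hd : 2 ≤ d)
    (hu : ContDiff ℝ (⊤ : ℕ∞) (Function.uncurry u)) (i : Fin d) :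
    Continuous (Function.uncurry (conformalFlux d u i)) := by
  have h0 := continuous_curried hu.continuous
  have h1 := continuous_curried (contDiff_timeDeriv hu).continuous
  have h2 := continuous_sum_mul_spaceDeriv hu
  have h3 := fun i => continuous_curried (contDiff_spaceDeriv hu i).continuous
  have h4 := (continuous_potential hd).comp h0
  simp only [Function.comp_def] at h4
  unfold conformalFlux Function.uncurry
  fun_prop

theorem continuous_conformalFluxDeriv (hd : 2 ≤ d)
    (hu : ContDiff ℝ (⊤ : ℕ∞) (Function.uncurry u)) (i : Fin d) :
    Continuous (Function.uncurry (conformalFluxDeriv d u i)) := by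
  have h2d : (2 : ℝ) ≤ d := by exact_mod_cast hd
  have hut := contDiff_timeDeriv hu
  have hux := contDiff_spaceDeriv hu
  have h0 := continuous_curried hu.continuous
  have h1 := continuous_curried hut.continuous
  have h2 := continuous_sum_mul_spaceDeriv hu
  have h3 := fun i => continuous_curried (hux i).continuous
  have h4 := (continuous_potential hd).comp h0
  have h5 := fun i => continuous_curried (contDiff_spaceDeriv hut i).continuous
  have h6 := fun i j => continuous_curried (contDiff_spaceDeriv (hux j) i).continuous
  have h7 : Continuous fun p : ℝ × Euc d => |u p.1 p.2| ^ ((4 : ℝ) / ((d : ℝ) - 1)) :=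
    h0.abs.rpow_const fun _ => Or.inr (div_nonneg (by norm_num) (by linarith))
  simp only [Function.comp_def] at h4
  unfold conformalFluxDeriv Function.uncurry
  fun_prop

theorem conformalDensity_eq_zero (hd : 2 ≤ d) {t : ℝ} {x : Euc d}
    (h : energyDensity d u t x = 0) : conformalDensity d u t x = 0 := by
  obtain ⟨h0, h1, h2⟩ := eq_zero_of_energyDensity_eq_zero hd h
  simp [conformalDensity, h, h0, h1, h2]

theorem conformalFlux_eq_zero (hd : 2 ≤ d) {t : ℝ} {x : Euc d}
    (h : energyDensity d u t x = 0) (i : Fin d) : conformalFlux d u i t x = 0 := by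
  obtain ⟨h0, h1, h2⟩ := eq_zero_of_energyDensity_eq_zero hd h
  simp [conformalFlux, h0, h1, h2, potential_zero hd]

theorem exists_energyDensity_eq_zero_of_norm_lt (hd : 2 ≤ d) {t : ℝ}
    (hu : ContDiff ℝ (⊤ : ℕ∞) (Function.uncurry u)) (h0 : HasCompactSupport (u t))
    (h1 : HasCompactSupport (fun x => timeDeriv d u t x)) :
    ∃ M, ∀ x, M < ‖x‖ → energyDensity d u t x = 0 := by
  obtain ⟨r, hr⟩ := h0.isCompact.isBounded.exists_norm_le
  obtain ⟨s, hs⟩ := h1.isCompact.isBounded.exists_norm_le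
  have hr' : ∀ x, r < ‖x‖ → u t x = 0 := fun x hx =>
    image_eq_zero_of_notMem_tsupport fun h => hx.not_ge (hr x h)
  have hs' : ∀ x, s < ‖x‖ → timeDeriv d u t x = 0 := fun x hx =>
    image_eq_zero_of_notMem_tsupport (f := fun x => timeDeriv d u t x) fun h => hx.not_ge (hs x h)
  refine ⟨max r s, fun x hx => ?_⟩
  have hxr := (le_max_left r s).trans_lt hx
  exact energyDensity_eq_zero hd (hr' x hxr) (hs' x ((le_max_right r s).trans_lt hx))
    fun i => spaceDeriv_eq_zero_of_norm_lt hu hr' i hxr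

/-- The integral of the conformal density does not increase. -/
theorem integral_conformalDensity_le (hd : 2 ≤ d)
    (hu : ContDiff ℝ (⊤ : ℕ∞) (Function.uncurry u))
    (heq : ∀ t x, timeDeriv2 d u t x - spatialLap d (u t) x
      + |u t x| ^ ((4 : ℝ) / ((d : ℝ) - 1)) * u t x = 0)
    {a M T : ℝ} (haT : a ≤ T) (h0 : ∀ x, M < ‖x‖ → energyDensity d u a x = 0) :
    ∫ x, conformalDensity d u T x ≤ ∫ x, conformalDensity d u a x := by
  have hsupp : ∀ t ∈ Icc a T, ∀ x, M + (T - a) < ‖x‖ → energyDensity d u t x = 0 :=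
    fun t ht x hx => energyDensity_eq_zero_of_lt hd hu heq ht.1 h0
      (by linarith [ht.2])
  exact integral_le_of_deriv_le_divergence volume haT (continuous_conformalDensity hd hu)
    (fun t x => hasDerivAt_conformalDensity hd hu t x (heq t x))
    (continuous_conformalFlux hd hu) (continuous_conformalFluxDeriv hd hu)
    (hasLineDerivAt_conformalFlux hd hu)
    (fun t ht x hx => conformalDensity_eq_zero hd (hsupp t ht x hx))
    (fun i t ht x hx => conformalFlux_eq_zero hd (hsupp t ht x hx) i)
    (fun t _ x => le_rfl)

theorem angularGradSq_nonneg (t : ℝ) (x : Euc d) : 0 ≤ angularGradSq d u t x := by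
  have h : |radialDeriv d u t x| ≤ ‖gradient (u t) x‖ := by
    rw [radialDeriv, abs_div, abs_norm]
    exact div_le_of_le_mul₀ (norm_nonneg _) (norm_nonneg _)
      ((abs_real_inner_le_norm _ _).trans_eq (mul_comm _ _))
  have := sq_le_sq' (neg_le_of_abs_le h) (le_of_abs_le h)
  exact sub_nonneg.2 this

/-- The conformal density in terms of null derivatives. -/
theorem conformalDensity_eq (t : ℝ) (x : Euc d) :
    conformalDensity d u t x =
      1 / 4 * (((t + ‖x‖) * Lop d u t x + ((d : ℝ) - 1) * u t x) ^ 2 +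
        ((t - ‖x‖) * Lbar d u t x + ((d : ℝ) - 1) * u t x) ^ 2)
      + 1 / 2 * ((t ^ 2 + ‖x‖ ^ 2) * angularGradSq d u t x)
      + (t ^ 2 + ‖x‖ ^ 2) * potential d (u t x) := by
  simp only [conformalDensity, energyDensity, Lop, Lbar, angularGradSq, radialDeriv,
    inner_gradient_eq_sum, norm_gradient_sq_eq_sum]
  rcases eq_or_ne x 0 with rfl | hx
  · simp
    ring
  · have : ‖x‖ ≠ 0 := norm_ne_zero_iff.2 hx
    field_simp
    ring

theorem mul_potential_le_conformalDensity (t : ℝ) (x : Euc d) :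
    (t ^ 2 + ‖x‖ ^ 2) * potential d (u t x) ≤ conformalDensity d u t x := by
  rw [conformalDensity_eq]
  have := angularGradSq_nonneg (u := u) t x
  exact le_add_of_nonneg_left (by positivity)

theorem measurable_radialDeriv (hu : ContDiff ℝ (⊤ : ℕ∞) (Function.uncurry u)) (t : ℝ) :
    Measurable (radialDeriv d u t) := by
  have h : Continuous fun x : Euc d => ∑ j, x j * spaceDeriv d j u t x :=
    (continuous_sum_mul_spaceDeriv hu).comp (Continuous.prodMk_right t)
  have : radialDeriv d u t = fun x => (∑ j, x j * spaceDeriv d j u t x) / ‖x‖ := by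
    funext x
    rw [radialDeriv, inner_gradient_eq_sum]
  rw [this]
  exact h.measurable.div continuous_norm.measurable

theorem integral_conformalDensity_le_conformalEnergy (hd : 2 ≤ d)
    (hu : ContDiff ℝ (⊤ : ℕ∞) (Function.uncurry u)) {t M : ℝ}
    (h0 : ∀ x, M < ‖x‖ → energyDensity d u t x = 0) :
    ∫ x, conformalDensity d u t x ≤ 2 * conformalEnergy d u t := by
  have h2d : (2 : ℝ) ≤ d := by exact_mod_cast hd
  have hcd : Integrable (conformalDensity d u t) :=
    integrable_of_eq_zero_of_norm_lt volume ((continuous_conformalDensity hd hu).uncurry_left t)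
      fun x hx => conformalDensity_eq_zero hd (h0 x hx)
  have hP : Integrable fun x : Euc d => (t ^ 2 + ‖x‖ ^ 2) * potential d (u t x) := by
    refine integrable_of_eq_zero_of_norm_lt (r := M) volume ?_ fun x hx => ?_
    · have := (continuous_potential hd).comp (hu.continuous.uncurry_left t)
      exact (by fun_prop : Continuous fun x : Euc d => t ^ 2 + ‖x‖ ^ 2).mul this
    · rw [(eq_zero_of_energyDensity_eq_zero hd (h0 x hx)).1, potential_zero hd, mul_zero]
  have hang := fun x => angularGradSq_nonneg (u := u) t x
  have hpot := fun x => potential_nonneg hd (u t x)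
  have hI : Integrable fun x : Euc d =>
      ((t + ‖x‖) * Lop d u t x + ((d : ℝ) - 1) * u t x) ^ 2 +
        ((t - ‖x‖) * Lbar d u t x + ((d : ℝ) - 1) * u t x) ^ 2 := by
    refine (hcd.const_mul 4).mono' (Measurable.aestronglyMeasurable ?_)
      (Filter.Eventually.of_forall fun x => ?_)
    · have h1 := measurable_radialDeriv hu t
      have h2 : Measurable (timeDeriv d u t) :=
        ((contDiff_timeDeriv hu).continuous.uncurry_left t).measurable
      have h3 : Measurable (u t) := (hu.continuous.uncurry_left t).measurable
      unfold Lop Lbar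
      fun_prop
    · rw [Real.norm_of_nonneg (by positivity), conformalDensity_eq]
      have := mul_nonneg (by positivity : 0 ≤ t ^ 2 + ‖x‖ ^ 2) (hang x)
      have := mul_nonneg (by positivity : 0 ≤ t ^ 2 + ‖x‖ ^ 2) (hpot x)
      linarith
  have hJ : Integrable fun x : Euc d => (t ^ 2 + ‖x‖ ^ 2) * angularGradSq d u t x := by
    refine (((hcd.sub (hI.const_mul (1 / 4))).sub hP).const_mul 2).congr
      (Filter.Eventually.of_forall fun x => ?_)
    simp only [Pi.sub_apply, conformalDensity_eq]
    ring
  have hE : ((d : ℝ) - 1) / (4 * ((d : ℝ) + 1)) *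
      ∫ x : Euc d, (t ^ 2 + ‖x‖ ^ 2) * |u t x| ^ (2 * ((d : ℝ) + 1) / ((d : ℝ) - 1)) =
      1 / 2 * ∫ x : Euc d, (t ^ 2 + ‖x‖ ^ 2) * potential d (u t x) := by
    rw [← integral_const_mul, ← integral_const_mul]
    refine integral_congr_ae (Filter.Eventually.of_forall fun x => ?_)
    have hk : ((d : ℝ) - 1) / (4 * ((d : ℝ) + 1)) =
        1 / 2 * (((d : ℝ) - 1) / (2 * ((d : ℝ) + 1))) := by
      have : (d : ℝ) + 1 ≠ 0 := by linarith
      field_simp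
      norm_num
    simp only [potential, hk]
    ring
  have hI0 : 0 ≤ ∫ x : Euc d, (((t + ‖x‖) * Lop d u t x + ((d : ℝ) - 1) * u t x) ^ 2 +
        ((t - ‖x‖) * Lbar d u t x + ((d : ℝ) - 1) * u t x) ^ 2) :=
    integral_nonneg fun x => by positivity
  have hJ0 : 0 ≤ ∫ x : Euc d, (t ^ 2 + ‖x‖ ^ 2) * angularGradSq d u t x :=
    integral_nonneg fun x => mul_nonneg (by positivity) (hang x)
  rw [conformalEnergy, hE]
  simp only [conformalDensity_eq]
  rw [integral_add ((hI.const_mul _).fun_add (hJ.const_mul _)) hP,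
    integral_add (hI.const_mul _) (hJ.const_mul _), integral_const_mul, integral_const_mul]
  linarith

theorem sq_mul_integral_potential_le (hd : 2 ≤ d)
    (hu : ContDiff ℝ (⊤ : ℕ∞) (Function.uncurry u)) {t M : ℝ}
    (h0 : ∀ x, M < ‖x‖ → energyDensity d u t x = 0) :
    Integrable (fun x => potential d (u t x)) ∧
      t ^ 2 * ∫ x, potential d (u t x) ≤ ∫ x, conformalDensity d u t x := by
  have hcd : Integrable (conformalDensity d u t) :=
    integrable_of_eq_zero_of_norm_lt volume ((continuous_conformalDensity hd hu).uncurry_left t)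
      fun x hx => conformalDensity_eq_zero hd (h0 x hx)
  have hP : Integrable fun x : Euc d => potential d (u t x) :=
    integrable_of_eq_zero_of_norm_lt (r := M) volume
      ((continuous_potential hd).comp (hu.continuous.uncurry_left t)) fun x hx => by
        rw [(eq_zero_of_energyDensity_eq_zero hd (h0 x hx)).1, potential_zero hd]
  refine ⟨hP, ?_⟩
  rw [← integral_const_mul]
  refine integral_mono (hP.const_mul _) hcd fun x => ?_
  refine le_trans ?_ (mul_potential_le_conformalDensity t x)
  have := potential_nonneg hd (u t x)
  gcongr
  exact le_add_of_nonneg_right (sq_nonneg _)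

theorem lintegral_Ioi_one_mul_rpow_neg_two {K : ℝ} (hK : 0 ≤ K) :
    ∫⁻ t in Ioi (1 : ℝ), ENNReal.ofReal (K * t ^ (-2 : ℝ)) = ENNReal.ofReal K := by
  rw [← ofReal_integral_eq_lintegral_ofReal
    ((integrableOn_Ioi_rpow_of_lt (by norm_num) one_pos).const_mul K), integral_const_mul,
    integral_Ioi_rpow_of_lt (by norm_num) one_pos]
  · norm_num
  · filter_upwards [ae_restrict_mem measurableSet_Ioi] with t ht
    have : (0 : ℝ) < t := one_pos.trans ht
    positivity

end Energy

/-- **Space-time integrability from the conformal energy** ((5.15) in Section 3).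
For `d ≥ 2` there is `C = C(d) > 0` such that every classical solution `u` of the
defocusing conformal NLW satisfies
`∫_1^∞ ∫_{ℝ^d} |u(t,x)|^{2(d+1)/(d−1)} dx dt ≤ C 𝓔(1)`. -/
theorem spacetime_bound_from_conformal_energy (d : ℕ) (hd : 2 ≤ d) :
    ∃ C : ℝ, 0 < C ∧
      ∀ u : ℝ → Euc d → ℝ, IsClassicalSolution d u →
        (∫⁻ t in Ioi (1 : ℝ), ∫⁻ x : Euc d,
            ENNReal.ofReal (|u t x| ^ (2 * ((d : ℝ) + 1) / ((d : ℝ) - 1)))) ≤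
          ENNReal.ofReal (C * conformalEnergy d u 1) := by
  have h2d : (2 : ℝ) ≤ d := by exact_mod_cast hd
  have hd1 : 0 < (d : ℝ) - 1 := by linarith
  refine ⟨4 * ((d : ℝ) + 1) / ((d : ℝ) - 1), by positivity, fun u hsol => ?_⟩
  obtain ⟨hu, hc0, hc1, heq⟩ := hsol
  obtain ⟨M, hM⟩ := exists_energyDensity_eq_zero_of_norm_lt hd hu (hc0 1) (hc1 1)
  have hE := integral_conformalDensity_le_conformalEnergy hd hu hM
  have hpot : ∀ y, |y| ^ (2 * ((d : ℝ) + 1) / ((d : ℝ) - 1)) =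
      2 * ((d : ℝ) + 1) / ((d : ℝ) - 1) * potential d y := fun y => by
    rw [potential]
    field_simp
  have hE0 : 0 ≤ conformalEnergy d u 1 := by
    have h1 := (sq_mul_integral_potential_le hd hu hM).2
    have h2 : 0 ≤ ∫ x, potential d (u 1 x) := integral_nonneg fun x => potential_nonneg hd _
    linarith
  rw [← lintegral_Ioi_one_mul_rpow_neg_two (by positivity)]
  refine setLIntegral_mono' measurableSet_Ioi fun t ht => ?_
  have ht0 : (0 : ℝ) < t := one_pos.trans ht
  have hsupp := fun x hx => energyDensity_eq_zero_of_lt hd hu heq (le_of_lt ht) hM (x₀ := x) hx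
  obtain ⟨hint, hle⟩ := sq_mul_integral_potential_le hd hu hsupp
  have hmono := integral_conformalDensity_le hd hu heq (le_of_lt ht) hM
  simp only [hpot]
  rw [← ofReal_integral_eq_lintegral_ofReal (hint.const_mul _)
    (Filter.Eventually.of_forall fun x => mul_nonneg (by positivity) (potential_nonneg hd _)),
    integral_const_mul]
  refine ENNReal.ofReal_le_ofReal ?_
  have hbound : ∫ x, potential d (u t x) ≤ 2 * conformalEnergy d u 1 * t ^ (-2 : ℝ) := by
    rw [Real.rpow_neg ht0.le, ← div_eq_mul_inv, Real.rpow_two, le_div_iff₀ (by positivity)]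
    linarith
  calc _ ≤ 2 * ((d : ℝ) + 1) / ((d : ℝ) - 1) * (2 * conformalEnergy d u 1 * t ^ (-2 : ℝ)) := by
        gcongr
    _ = _ := by ring
end
end
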